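/- For every n ≥ 1 and every basepoint c ∈ Conf_n(ℝ³), the second homotopy group π₂(Conf_n(ℝ³), c) is a free abelian group of rank n(n−1)/2; that is, it is isomorphic as a group to ℤ^{n(n−1)/2}. -/

import Mathlib

open scoped Topology

noncomputable section

/-- `ℝ³` with the Euclidean metric. -/
abbrev R3 : Type := EuclideanSpace ℝ (Fin 3)

/-- The configuration space of `n` (ordered, distinct) points in the subset `A ⊆ ℝ³`,
topologised as a subspace of `(ℝ³)^n`. -/
def Conf (n : ℕ) (A : Set R3) : Type :=
  {x : Fin n → R3 // Function.Injective x ∧ ∀ m, x m ∈ A}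

instance (n : ℕ) (A : Set R3) : TopologicalSpace (Conf n A) :=
  instTopologicalSpaceSubtype

/-! ### Free homotopies of maps that are constant on the boundary of the square -/

/-- The unit square. -/
abbrev Sq : Type := Fin 2 → unitInterval

section FreeHomotopy

variable {X Y : Type*} [TopologicalSpace X] [TopologicalSpace Y]

/-- The map is constant on the boundary of the square. -/
def ConstOnBoundary (f : Sq → X) : Prop :=
  ∀ s ∈ Cube.boundary (Fin 2), ∀ s' ∈ Cube.boundary (Fin 2), f s = f s'

/-- Homotopy inside the subset `S`, through maps that are constant on the boundary of the square
(with a value that may move during the homotopy). -/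
def FreelyHomotopicIn (S : Set X) (f g : C(Sq, X)) : Prop :=
  f.HomotopicWith g fun h => ConstOnBoundary h ∧ ∀ s, h s ∈ S

namespace FreelyHomotopicIn

variable {S : Set X} {f g h : C(Sq, X)}

theorem iff_exists : FreelyHomotopicIn S f g ↔
    ∃ H : C(unitInterval × Sq, X), (∀ s, H (0, s) = f s) ∧ (∀ s, H (1, s) = g s) ∧
      (∀ t, ConstOnBoundary fun s => H (t, s)) ∧ ∀ x, H x ∈ S := by
  constructor
  · rintro ⟨H⟩
    exact ⟨H.toContinuousMap, H.apply_zero, H.apply_one, fun t => (H.prop' t).1,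
      fun x => (H.prop' x.1).2 x.2⟩
  · rintro ⟨H, h0, h1, hb, hS⟩
    exact ⟨{ toContinuousMap := H, map_zero_left := h0, map_one_left := h1
             prop' := fun t => ⟨hb t, fun s => hS (t, s)⟩ }⟩

theorem refl (hb : ConstOnBoundary f) (hS : ∀ s, f s ∈ S) : FreelyHomotopicIn S f f :=
  ContinuousMap.HomotopicWith.refl f ⟨hb, hS⟩

theorem symm (H : FreelyHomotopicIn S f g) : FreelyHomotopicIn S g f :=
  ContinuousMap.HomotopicWith.symm H

theorem trans (H : FreelyHomotopicIn S f g) (H' : FreelyHomotopicIn S g h) :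
    FreelyHomotopicIn S f h :=
  ContinuousMap.HomotopicWith.trans H H'

theorem map {S' : Set Y} (H : FreelyHomotopicIn S f g) {φ : X → Y} (hφ : ContinuousOn φ S)
    (hS : Set.MapsTo φ S S') {f' g' : C(Sq, Y)} (hf : ∀ s, f' s = φ (f s))
    (hg : ∀ s, g' s = φ (g s)) : FreelyHomotopicIn S' f' g' := by
  obtain ⟨H, h0, h1, hb, hm⟩ := iff_exists.1 H
  refine iff_exists.2 ⟨⟨fun x => φ (H x), hφ.comp_continuous H.continuous hm⟩, ?_, ?_, ?_, ?_⟩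
  · intro s; simp [h0, hf]
  · intro s; simp [h1, hg]
  · intro t s hs s' hs'; exact congrArg φ (hb t s hs s' hs')
  · intro x; exact hS (hm x)

theorem right (H : FreelyHomotopicIn S f g) : ConstOnBoundary g ∧ ∀ s, g s ∈ S := by
  obtain ⟨H, -, h1, hb, hm⟩ := iff_exists.1 H
  exact ⟨fun s hs s' hs' => by simpa [h1] using hb 1 s hs s' hs', fun s => h1 s ▸ hm (1, s)⟩

theorem left (H : FreelyHomotopicIn S f g) : ConstOnBoundary f ∧ ∀ s, f s ∈ S :=
  H.symm.right

/-- The straight-line homotopy. -/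
theorem of_segment {V : Type*} [AddCommGroup V] [Module ℝ V] [TopologicalSpace V]
    [IsTopologicalAddGroup V] [ContinuousSMul ℝ V] {S : Set V} {f g : C(Sq, V)}
    (hf : ConstOnBoundary f) (hg : ConstOnBoundary g)
    (hS : ∀ s, ∀ t : unitInterval, (1 - (t : ℝ)) • f s + (t : ℝ) • g s ∈ S) :
    FreelyHomotopicIn S f g := by
  refine iff_exists.2 ⟨⟨fun x => (1 - (x.1 : ℝ)) • f x.2 + (x.1 : ℝ) • g x.2, by fun_prop⟩,
    ?_, ?_, ?_, ?_⟩
  · intro s; simp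
  · intro s; simp
  · intro t s hs s' hs'
    simp [hf s hs s' hs', hg s hs s' hs']
  · intro x; exact hS x.2 x.1

end FreelyHomotopicIn

theorem Sq.zero_mem_boundary : (0 : Sq) ∈ Cube.boundary (Fin 2) := ⟨0, Or.inl rfl⟩

/-- Expansion of the square about its centre, truncated to the square. -/
def expandSq (t : unitInterval) (s : Sq) : Sq := fun i =>
  Set.projIcc 0 1 zero_le_one ((s i : ℝ) + t * (s i - 1 / 2))

theorem continuous_expandSq : Continuous fun x : unitInterval × Sq => expandSq x.1 x.2 := by
  unfold expandSq
  refine continuous_pi fun i => continuous_projIcc.comp ?_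
  fun_prop

theorem Continuous.expandSq {Z : Type*} [TopologicalSpace Z] {t : Z → unitInterval} {s : Z → Sq}
    (ht : Continuous t) (hs : Continuous s) : Continuous fun z => expandSq (t z) (s z) :=
  continuous_expandSq.comp (ht.prodMk hs)

@[simp] theorem expandSq_zero (s : Sq) : expandSq 0 s = s := by
  ext i; simp [expandSq]

theorem expandSq_mem_boundary (t : unitInterval) {s : Sq} (hs : s ∈ Cube.boundary (Fin 2)) :
    expandSq t s ∈ Cube.boundary (Fin 2) := by
  obtain ⟨i, hi⟩ := hs
  refine ⟨i, hi.imp (fun h => ?_) fun h => ?_⟩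
  · exact Set.projIcc_of_le_left _ (by simp [h]; linarith [t.2.1])
  · exact Set.projIcc_of_right_le _ (by simp [h]; norm_num; linarith [t.2.1])

/-- The height over the square that is `0` on the boundary and `1` on the middle square. -/
def collarSq (s : Sq) : unitInterval :=
  ∏ i, (Set.projIcc 0 1 zero_le_one (4 * (s i : ℝ)) *
    Set.projIcc 0 1 zero_le_one (4 * (1 - (s i : ℝ))))

theorem continuous_collarSq : Continuous collarSq := by
  unfold collarSq
  simp only [Fin.prod_univ_two]
  have h (i : Fin 2) : Continuous fun s : Sq => Set.projIcc (0 : ℝ) 1 zero_le_one (4 * (s i : ℝ)) :=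
    continuous_projIcc.comp (by fun_prop)
  have h' (i : Fin 2) : Continuous fun s : Sq =>
      Set.projIcc (0 : ℝ) 1 zero_le_one (4 * (1 - (s i : ℝ))) :=
    continuous_projIcc.comp (by fun_prop)
  exact ((h 0).mul (h' 0)).mul ((h 1).mul (h' 1))

theorem collarSq_of_mem_boundary {s : Sq} (hs : s ∈ Cube.boundary (Fin 2)) : collarSq s = 0 := by
  obtain ⟨i, hi⟩ := hs
  refine Finset.prod_eq_zero (Finset.mem_univ i) ?_
  rcases hi with h | h
  · rw [h, Set.projIcc_of_le_left _ (by simp)]; exact zero_mul _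
  · rw [h, Set.projIcc_of_le_left (x := 4 * (1 - ((1 : unitInterval) : ℝ))) _ (by simp)]
    exact mul_zero _

/-- Either the expanded point is on the boundary, or the height is `1`. -/
theorem collarSq_eq_one {s : Sq} (hs : ∀ i, 1 / 4 ≤ (s i : ℝ) ∧ (s i : ℝ) ≤ 3 / 4) :
    collarSq s = 1 := by
  refine Finset.prod_eq_one fun i _ => ?_
  rw [Set.projIcc_of_right_le _ (by linarith [(hs i).1]),
    Set.projIcc_of_right_le _ (by linarith [(hs i).2])]
  exact one_mul _

theorem expandSq_one_mem_boundary {s : Sq} (hs : ∃ i, (s i : ℝ) ≤ 1 / 4 ∨ 3 / 4 ≤ (s i : ℝ)) :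
    expandSq 1 s ∈ Cube.boundary (Fin 2) := by
  obtain ⟨i, hi⟩ := hs
  refine ⟨i, hi.imp (fun h => ?_) fun h => ?_⟩
  · exact Set.projIcc_of_le_left _ (by simp; linarith)
  · exact Set.projIcc_of_right_le _ (by simp; linarith)

theorem freelyHomotopicIn_expandSq {S : Set X} {f : C(Sq, X)} (hb : ConstOnBoundary f)
    (hS : ∀ s, f s ∈ S) :
    FreelyHomotopicIn S f (f.comp ⟨expandSq 1, continuous_const.expandSq continuous_id⟩) :=
  FreelyHomotopicIn.iff_exists.2 ⟨f.comp ⟨_, continuous_expandSq⟩, fun s => by simp,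
    fun s => rfl, fun t s hs s' hs' =>
      hb _ (expandSq_mem_boundary t hs) _ (expandSq_mem_boundary t hs'), fun x => hS _⟩

/-- A generalized loop that is freely null-homotopic is null-homotopic. -/
theorem GenLoop.homotopic_const_of_freelyHomotopicIn {x : X} {S : Set X}
    (f : GenLoop (Fin 2) X x) {c : X}
    (H : FreelyHomotopicIn S (f : C(Sq, X)) (ContinuousMap.const _ c)) :
    GenLoop.Homotopic f GenLoop.const := by
  obtain ⟨H, h0, h1, hb, -⟩ := FreelyHomotopicIn.iff_exists.1 H
  have hx : ∀ s ∈ Cube.boundary (Fin 2), H (0, s) = x := fun s hs => (h0 s).trans (f.2 s hs)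
  have hcol : ∀ s, H (collarSq s, expandSq 1 s) = H (collarSq s, 0) := by
    intro s
    by_cases hs : ∀ i, 1 / 4 ≤ (s i : ℝ) ∧ (s i : ℝ) ≤ 3 / 4
    · rw [collarSq_eq_one hs, h1, h1]; rfl
    · push Not at hs
      refine hb _ _ (expandSq_one_mem_boundary ?_) _ Sq.zero_mem_boundary
      obtain ⟨i, hi⟩ := hs
      by_cases h : (s i : ℝ) ≤ 1 / 4
      · exact ⟨i, Or.inl h⟩
      · exact ⟨i, Or.inr (hi (by linarith)).le⟩
  let f₁ : C(Sq, X) := ⟨fun s => H (0, expandSq 1 s),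
    H.continuous.comp (continuous_const.prodMk (continuous_const.expandSq continuous_id))⟩
  let f₂ : C(Sq, X) := ⟨fun s => H (collarSq s, 0),
    H.continuous.comp (continuous_collarSq.prodMk continuous_const)⟩
  have e₁ : (f : C(Sq, X)).HomotopicRel f₁ (Cube.boundary (Fin 2)) :=
    ⟨{ toFun := fun y => H (0, expandSq y.1 y.2)
       continuous_toFun := H.continuous.comp (continuous_const.prodMk continuous_expandSq)
       map_zero_left := fun s => by simp [h0]
       map_one_left := fun s => rfl
       prop' := fun t s hs => by
        change H (0, expandSq t s) = f s
        exact (hx _ (expandSq_mem_boundary t hs)).trans (f.2 s hs).symm }⟩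
  have e₂ : f₁.HomotopicRel f₂ (Cube.boundary (Fin 2)) :=
    ⟨{ toFun := fun y => H (y.1 ⊓ collarSq y.2, expandSq 1 y.2)
       continuous_toFun := H.continuous.comp
        ((continuous_fst.inf (continuous_collarSq.comp continuous_snd)).prodMk
          (continuous_const.expandSq continuous_snd))
       map_zero_left := fun s => by
        change H (0 ⊓ collarSq s, _) = H (0, _)
        rw [inf_eq_left.2 unitInterval.nonneg']
       map_one_left := fun s => by
        change H (1 ⊓ collarSq s, _) = H (collarSq s, 0)
        rw [inf_eq_right.2 unitInterval.le_one', hcol]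
       prop' := fun t s hs => by
        change H (t ⊓ collarSq s, _) = H (0, _)
        rw [collarSq_of_mem_boundary hs, inf_eq_right.2 unitInterval.nonneg'] }⟩
  have e₃ : f₂.HomotopicRel (GenLoop.const : GenLoop (Fin 2) X x).1 (Cube.boundary (Fin 2)) :=
    ⟨{ toFun := fun y => H (unitInterval.symm y.1 ⊓ collarSq y.2, 0)
       continuous_toFun := H.continuous.comp
        (((unitInterval.continuous_symm.comp continuous_fst).inf
          (continuous_collarSq.comp continuous_snd)).prodMk continuous_const)
       map_zero_left := fun s => by
        change H (unitInterval.symm 0 ⊓ collarSq s, 0) = H (collarSq s, 0)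
        rw [unitInterval.symm_zero, inf_eq_right.2 unitInterval.le_one']
       map_one_left := fun s => by
        change H (unitInterval.symm 1 ⊓ collarSq s, 0) = x
        rw [unitInterval.symm_one, inf_eq_left.2 unitInterval.nonneg']
        exact hx _ Sq.zero_mem_boundary
       prop' := fun t s hs => by
        change H (_ ⊓ collarSq s, 0) = H (collarSq s, 0)
        rw [collarSq_of_mem_boundary hs, inf_eq_right.2 unitInterval.nonneg'] }⟩
  exact (e₁.trans e₂).trans e₃

/-- Moving the boundary value of a map of the square along a path. -/
theorem exists_genLoop_freelyHomotopicIn {c : X} {f : C(Sq, X)} (hb : ConstOnBoundary f)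
    (γ : Path c (f 0)) :
    ∃ f' : GenLoop (Fin 2) X c, FreelyHomotopicIn Set.univ (f' : C(Sq, X)) f := by
  classical
  let H : unitInterval × Sq → X := fun y =>
    if expandSq 1 y.2 ∈ Cube.boundary (Fin 2) then γ (y.1 ⊔ collarSq y.2) else f (expandSq 1 y.2)
  let A : Set (unitInterval × Sq) := {y | ∀ i, 1 / 4 ≤ (y.2 i : ℝ) ∧ (y.2 i : ℝ) ≤ 3 / 4}
  let B : Set (unitInterval × Sq) := {y | ∃ i, (y.2 i : ℝ) ≤ 1 / 4 ∨ 3 / 4 ≤ (y.2 i : ℝ)}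
  have hA : IsClosed A := by
    have hA' : A = ⋂ i, ({y | (1 / 4 : ℝ) ≤ y.2 i} ∩ {y | (y.2 i : ℝ) ≤ 3 / 4}) := by
      ext y; simp [A]
    rw [hA']
    exact isClosed_iInter fun i => (isClosed_le (by fun_prop) (by fun_prop)).inter
      (isClosed_le (by fun_prop) (by fun_prop))
  have hB : IsClosed B := by
    have hB' : B = ⋃ i, ({y | (y.2 i : ℝ) ≤ 1 / 4} ∪ {y | (3 / 4 : ℝ) ≤ y.2 i}) := by
      ext y; simp [B]
    rw [hB']
    exact isClosed_iUnion_of_finite fun i => (isClosed_le (by fun_prop) (by fun_prop)).union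
      (isClosed_le (by fun_prop) (by fun_prop))
  have hAB : A ∪ B = Set.univ := by
    refine Set.eq_univ_of_forall fun y => ?_
    by_cases hy : y ∈ A
    · exact Or.inl hy
    · refine Or.inr ?_
      change ¬ ∀ i, 1 / 4 ≤ (y.2 i : ℝ) ∧ (y.2 i : ℝ) ≤ 3 / 4 at hy
      push Not at hy
      obtain ⟨i, hi⟩ := hy
      by_cases h : (y.2 i : ℝ) ≤ 1 / 4
      · exact ⟨i, Or.inl h⟩
      · exact ⟨i, Or.inr (hi (by linarith)).le⟩
  have hexp : Continuous fun y : unitInterval × Sq => expandSq 1 y.2 :=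
    continuous_const.expandSq continuous_snd
  have hHA : Set.EqOn H (fun y => f (expandSq 1 y.2)) A := by
    intro y hy
    simp only [H]
    split_ifs with h
    · rw [collarSq_eq_one hy, sup_eq_right.2 unitInterval.le_one', γ.target,
        hb _ h _ Sq.zero_mem_boundary]
    · rfl
  have hHB : Set.EqOn H (fun y => γ (y.1 ⊔ collarSq y.2)) B := by
    intro y hy
    simp only [H]
    rw [if_pos (expandSq_one_mem_boundary hy)]
  have hH : Continuous H := by
    rw [← continuousOn_univ, ← hAB]
    refine ContinuousOn.union_of_isClosed ?_ ?_ hA hB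
    · exact ((f.continuous.comp hexp).continuousOn).congr hHA
    · exact ((γ.continuous.comp (continuous_fst.sup
        (continuous_collarSq.comp continuous_snd))).continuousOn).congr hHB
  have hbd : ∀ t s, s ∈ Cube.boundary (Fin 2) → H (t, s) = γ t := by
    intro t s hs
    simp only [H]
    rw [if_pos (expandSq_mem_boundary 1 hs), collarSq_of_mem_boundary hs,
      sup_eq_left.2 unitInterval.nonneg']
  refine ⟨⟨⟨fun s => H (0, s), hH.comp (by fun_prop)⟩, fun s hs => ?_⟩, ?_⟩
  · exact (hbd 0 s hs).trans γ.source
  · refine FreelyHomotopicIn.trans (FreelyHomotopicIn.iff_exists.2 ⟨⟨H, hH⟩, fun s => rfl, ?_,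
      fun t s hs s' hs' => ?_, fun _ => Set.mem_univ _⟩) (freelyHomotopicIn_expandSq hb
        fun _ => Set.mem_univ _).symm
    · intro s
      simp only [H, ContinuousMap.coe_mk, ContinuousMap.comp_apply]
      split_ifs with h
      · rw [sup_eq_left.2 unitInterval.le_one', γ.target, hb _ h _ Sq.zero_mem_boundary]
      · rfl
    · exact (hbd t s hs).trans (hbd t s' hs').symm

end FreeHomotopy

/-! ### Homotopy lifting along maps with a local transport -/

section Lifting

variable {K E B : Type*} [TopologicalSpace K] [CompactSpace K] [TopologicalSpace E]
  [TopologicalSpace B]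

theorem exists_subdivision {U : Set (B × B)} (hU : IsOpen U) (F : C(unitInterval × K, B))
    (hF : ∀ x, (F x, F x) ∈ U) :
    ∃ N : ℕ, 0 < N ∧ ∀ t t' : unitInterval, ∀ k, |(t : ℝ) - t'| ≤ 1 / N →
      (F (t, k), F (t', k)) ∈ U := by
  let W : Set (unitInterval × unitInterval) := {x | ∀ k, (F (x.1, k), F (x.2, k)) ∈ U}
  have hW : IsOpen W := by
    have hc : Continuous fun y : (unitInterval × unitInterval) × K =>
        (F (y.1.1, y.2), F (y.1.2, y.2)) := by fun_prop
    have hcl := isClosedMap_fst_of_compactSpace (X := unitInterval × unitInterval) (Y := K) _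
      (hU.preimage hc).isClosed_compl
    convert hcl.isOpen_compl using 1
    ext x
    simp [W]
  have hd : W ∈ uniformity unitInterval := by
    rw [← nhdsSet_diagonal_eq_uniformity]
    refine hW.mem_nhdsSet.2 ?_
    rintro ⟨a, b⟩ hab
    obtain rfl : a = b := hab
    exact fun k => hF _
  obtain ⟨ε, hε, h⟩ := Metric.mem_uniformity_dist.1 hd
  obtain ⟨n, hn⟩ := exists_nat_one_div_lt hε
  refine ⟨n + 1, n.succ_pos, fun t t' k htt => ?_⟩
  refine h (a := t) (b := t') ?_ k
  rw [Subtype.dist_eq, Real.dist_eq]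
  exact htt.trans_lt (by exact_mod_cast hn)

/-- The truncation `t ⊓ j / N`. -/
def truncI (N j : ℕ) (t : unitInterval) : unitInterval :=
  t ⊓ Set.projIcc 0 1 zero_le_one ((j : ℝ) / N)

theorem continuous_truncI (N j : ℕ) : Continuous (truncI N j) :=
  continuous_id.inf continuous_const

theorem truncI_zero_left (N : ℕ) (t : unitInterval) : truncI N 0 t = 0 := by
  rw [truncI, Set.projIcc_of_le_left _ (by simp)]
  exact inf_eq_right.2 unitInterval.nonneg'

theorem truncI_self {N : ℕ} (hN : 0 < N) (t : unitInterval) : truncI N N t = t := by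
  have : (N : ℝ) ≠ 0 := by positivity
  rw [truncI, Set.projIcc_of_right_le _ (by rw [div_self this])]
  exact inf_eq_left.2 unitInterval.le_one'

theorem truncI_zero (N j : ℕ) : truncI N j 0 = 0 := inf_eq_left.2 unitInterval.nonneg'

theorem abs_truncI_sub (N j : ℕ) (t : unitInterval) :
    |(truncI N j t : ℝ) - truncI N (j + 1) t| ≤ 1 / N := by
  have e : ∀ j, (truncI N j t : ℝ) = min (t : ℝ) ((j : ℝ) / N) := by
    intro j
    have hc : ∀ x y : unitInterval, ((x ⊓ y : unitInterval) : ℝ) = min (x : ℝ) y := by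
      intro x y
      rcases le_total x y with h | h
      · rw [inf_eq_left.2 h, min_eq_left (Subtype.coe_le_coe.2 h)]
      · rw [inf_eq_right.2 h, min_eq_right (Subtype.coe_le_coe.2 h)]
    rw [truncI, hc, Set.coe_projIcc]
    have h1 := t.2.1
    have h2 := t.2.2
    have h3 : 0 ≤ (j : ℝ) / N := by positivity
    rw [max_eq_right (le_min zero_le_one h3)]
    rw [← min_assoc, min_eq_left h2]
  rw [e, e]
  refine (abs_min_sub_min_le_max _ _ _ _).trans ?_
  rw [sub_self, abs_zero, ← sub_div, Nat.cast_add, sub_add_cancel_left, Nat.cast_one, neg_div,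
    abs_neg, abs_of_nonneg (by positivity), max_eq_right (by positivity)]

/-- Homotopy lifting for a map `p` with a transport `T b e` of points `e` of the total space `S` to
nearby fibres. The lift is stationary where the homotopy is, and it respects the symmetries of
the transport. -/
theorem exists_transport_lift (p : E → B) {S : Set E} {U : Set (B × B)} (hU : IsOpen U)
    (T : B → E → E)
    (hTc : ContinuousOn (fun x : B × E => T x.1 x.2) {x | x.2 ∈ S ∧ (p x.2, x.1) ∈ U})
    (hTS : ∀ b e, e ∈ S → (p e, b) ∈ U → T b e ∈ S ∧ p (T b e) = b)
    (hTr : ∀ e ∈ S, T (p e) e = e)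
    (F : C(unitInterval × K, B)) (hF : ∀ x, (F x, F x) ∈ U) (e₀ : C(K, E))
    (he₀ : ∀ k, e₀ k ∈ S ∧ p (e₀ k) = F (0, k)) :
    ∃ G : C(unitInterval × K, E), (∀ x, G x ∈ S ∧ p (G x) = F x) ∧ (∀ k, G (0, k) = e₀ k) ∧
      (∀ k, (∀ t, F (t, k) = F (0, k)) → ∀ t, G (t, k) = e₀ k) ∧
      ∀ g : E → E, (∀ b, ∀ e ∈ S, (p e, b) ∈ U → T b (g e) = g (T b e)) →
        ∀ k k', (∀ t, F (t, k) = F (t, k')) → e₀ k = g (e₀ k') → ∀ t, G (t, k) = g (G (t, k')) := by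
  obtain ⟨N, hN, hsub⟩ := exists_subdivision hU F hF
  have key : ∀ j : ℕ, ∃ G : C(unitInterval × K, E),
      (∀ t k, G (t, k) ∈ S ∧ p (G (t, k)) = F (truncI N j t, k)) ∧ (∀ k, G (0, k) = e₀ k) ∧
      (∀ k, (∀ t, F (t, k) = F (0, k)) → ∀ t, G (t, k) = e₀ k) ∧
      ∀ g : E → E, (∀ b, ∀ e ∈ S, (p e, b) ∈ U → T b (g e) = g (T b e)) →
        ∀ k k', (∀ t, F (t, k) = F (t, k')) → e₀ k = g (e₀ k') →
          ∀ t, G (t, k) = g (G (t, k')) := by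
    intro j
    induction j with
    | zero =>
      refine ⟨e₀.comp ⟨Prod.snd, continuous_snd⟩, fun t k => ?_, fun _ => rfl, fun _ _ _ => rfl,
        fun g _ k k' _ h _ => h⟩
      rw [truncI_zero_left]
      exact he₀ k
    | succ j ih =>
      obtain ⟨G, hG, hG0, hGr, hGg⟩ := ih
      have hmem : ∀ t k, (p (G (t, k)), F (truncI N (j + 1) t, k)) ∈ U := fun t k => by
        rw [(hG t k).2]
        exact hsub _ _ _ (abs_truncI_sub N j t)
      refine ⟨⟨fun x => T (F (truncI N (j + 1) x.1, x.2)) (G x), ?_⟩, fun t k => ?_, fun k => ?_,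
        fun k hk t => ?_, fun g hg k k' hk h t => ?_⟩
      · have hc : Continuous fun x : unitInterval × K => (F (truncI N (j + 1) x.1, x.2), G x) := by
          have := continuous_truncI N (j + 1)
          fun_prop
        exact hTc.comp_continuous hc fun x => ⟨(hG x.1 x.2).1, hmem x.1 x.2⟩
      · exact hTS _ _ (hG t k).1 (hmem t k)
      · change T (F (truncI N (j + 1) 0, k)) (G (0, k)) = _
        rw [hG0, truncI_zero, ← (he₀ k).2, hTr _ (he₀ k).1]
      · change T (F (truncI N (j + 1) t, k)) (G (t, k)) = _
        rw [hGr k hk, hk, ← (he₀ k).2, hTr _ (he₀ k).1]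
      · change T (F (truncI N (j + 1) t, k)) (G (t, k)) = g (T (F (truncI N (j + 1) t, k')) _)
        rw [hk, hGg g hg k k' hk h, hg _ _ (hG t k').1 (hmem t k')]
  obtain ⟨G, hG, h⟩ := key N
  exact ⟨G, fun x => by simpa [truncI_self hN] using hG x.1 x.2, h⟩

end Lifting

/-! ### Angles of circle-valued maps -/

theorem Circle.continuous_coe : Continuous fun a : Circle => (a : ℂ) := continuous_subtype_val

theorem exists_angle {X : Type*} [TopologicalSpace X] [CompactSpace X] {x₀ : X}
    (c : C(unitInterval × X, X)) (h0 : ∀ x, c (0, x) = x₀) (h1 : ∀ x, c (1, x) = x)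
    (hc : ∀ t, c (t, x₀) = x₀) (a : C(X, Circle)) {θ₀ : ℝ} (hθ₀ : Circle.exp θ₀ = a x₀) :
    ∃ θ : C(X, ℝ), θ x₀ = θ₀ ∧ ∀ x, Circle.exp (θ x) = a x := by
  have hd : Continuous fun x : Circle × Circle => ((x.2 / x.1 : Circle) : ℂ) :=
    Circle.continuous_coe.comp (continuous_snd.div' continuous_fst)
  have hU : IsOpen {x : Circle × Circle | ((x.2 / x.1 : Circle) : ℂ) ∈ Complex.slitPlane} :=
    Complex.isOpen_slitPlane.preimage hd
  have hT : ContinuousOn (fun x : Circle × ℝ => x.2 + Complex.arg (x.1 / Circle.exp x.2 : Circle))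
      {x | x.2 ∈ Set.univ ∧
        ((x.1 / Circle.exp x.2 : Circle) : ℂ) ∈ Complex.slitPlane} := by
    intro x hx
    have hcont : ContinuousAt (fun x : Circle × ℝ => ((x.1 / Circle.exp x.2 : Circle) : ℂ)) x :=
      (hd.comp (((Circle.exp.continuous.comp continuous_snd)).prodMk continuous_fst)).continuousAt
    exact (continuousAt_snd.add (ContinuousAt.comp (f := fun x : Circle × ℝ =>
      ((x.1 / Circle.exp x.2 : Circle) : ℂ)) (Complex.continuousAt_arg hx.2)
        hcont)).continuousWithinAt
  obtain ⟨G, hG, -, hGr, -⟩ := exists_transport_lift (K := X) Circle.exp (S := Set.univ) hU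
    (fun b θ => θ + Complex.arg (b / Circle.exp θ : Circle)) hT
    (fun b θ _ _ => ⟨trivial, by rw [Circle.exp_add, Circle.exp_arg, mul_div_cancel]⟩)
    (fun θ _ => by simp) (a.comp c) (fun x => by simp) (ContinuousMap.const _ θ₀)
    (fun x => ⟨trivial, by simp [hθ₀, h0]⟩)
  refine ⟨G.comp ⟨fun x => (1, x), by fun_prop⟩, ?_, fun x => ?_⟩
  · exact hGr x₀ (fun t => by simp [hc]) 1
  · simpa [h1] using (hG (1, x)).2

theorem exists_angle_Sq (a : C(Sq, Circle)) :
    ∃ θ : C(Sq, ℝ), ∀ s, Circle.exp (θ s) = a s := by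
  obtain ⟨θ, -, h⟩ := exists_angle (x₀ := (0 : Sq)) ⟨fun x i => x.1 * x.2 i, by fun_prop⟩
    (fun s => by ext; simp) (fun s => by ext; simp) (fun s => by ext; simp) a
    (Circle.exp_arg (a 0))
  exact ⟨θ, h⟩

theorem exists_angle_unitInterval (a : C(unitInterval, Circle)) {θ₀ : ℝ}
    (h₀ : Circle.exp θ₀ = a 0) :
    ∃ θ : C(unitInterval, ℝ), θ 0 = θ₀ ∧ ∀ s, Circle.exp (θ s) = a s :=
  exists_angle (x₀ := (0 : unitInterval)) ⟨fun x => x.1 * x.2, by fun_prop⟩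
    (fun s => by ext; simp) (fun s => by ext; simp) (fun s => by ext; simp) a h₀

/-! ### The Hopf map -/

section Hopf

open ComplexConjugate Complex

/-- The Hopf map `ℂ² → ℂ × ℝ`. -/
def hopf (q : ℂ × ℂ) : ℂ × ℝ := (q.1 * q.2, normSq q.1 - normSq q.2)

theorem continuous_hopf : Continuous hopf := by
  unfold hopf
  have := continuous_normSq
  fun_prop

/-- The action of the circle on `ℂ²` whose orbits are the fibres of the Hopf map. -/
def rotHopf (a : Circle) (q : ℂ × ℂ) : ℂ × ℂ := ((a : ℂ) * q.1, ((a⁻¹ : Circle) : ℂ) * q.2)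

theorem Continuous.rotHopf {Z : Type*} [TopologicalSpace Z] {a : Z → Circle} {q : Z → ℂ × ℂ}
    (ha : Continuous a) (hq : Continuous q) : Continuous fun z => rotHopf (a z) (q z) := by
  unfold _root_.rotHopf
  fun_prop

@[simp] theorem rotHopf_one (q : ℂ × ℂ) : rotHopf 1 q = q := by simp [rotHopf]

theorem rotHopf_rotHopf (a b : Circle) (q : ℂ × ℂ) :
    rotHopf a (rotHopf b q) = rotHopf (a * b) q := by
  simp [rotHopf, mul_comm, mul_left_comm]

@[simp] theorem hopf_rotHopf (a : Circle) (q : ℂ × ℂ) : hopf (rotHopf a q) = hopf q := by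
  ext1
  · simp only [hopf, rotHopf, Circle.coe_inv]
    have := a.coe_ne_zero
    field_simp
  · simp [hopf, rotHopf, normSq_mul]

theorem hopf_surjective (b : ℂ × ℝ) : ∃ q, hopf q = b := by
  obtain ⟨u, x⟩ := b
  set r := √(x ^ 2 + 4 * normSq u) with hr
  have hr2 : r ^ 2 = x ^ 2 + 4 * normSq u :=
    Real.sq_sqrt (by have := normSq_nonneg u; positivity)
  have hrx : |x| ≤ r := Real.abs_le_sqrt (by linarith [normSq_nonneg u])
  have h1 := abs_le.1 hrx
  rcases eq_or_lt_of_le (show 0 ≤ r + x by linarith) with h | h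
  · have hx : x = -r := by linarith
    have hu : u = 0 := by
      rw [← normSq_eq_zero]
      rw [hx] at hr2
      linarith
    refine ⟨(0, (√r : ℝ)), ?_⟩
    simp [hopf, hu, normSq_ofReal, Real.mul_self_sqrt (show 0 ≤ r from Real.sqrt_nonneg _), hx]
  · have hA : 0 < (r + x) / 2 := by linarith
    have hs : √((r + x) / 2) ≠ 0 := (Real.sqrt_pos.2 hA).ne'
    refine ⟨((√((r + x) / 2) : ℝ), u / (√((r + x) / 2) : ℝ)), ?_⟩
    have : ((√((r + x) / 2) : ℝ) : ℂ) ≠ 0 := by exact_mod_cast hs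
    simp only [hopf, Prod.mk.injEq]
    refine ⟨by field_simp, ?_⟩
    rw [normSq_div, normSq_ofReal, Real.mul_self_sqrt hA.le]
    field_simp
    linear_combination hr2

/-- The quotient of two points in the same fibre of the Hopf map. -/
def hopfRatio (q' q : ℂ × ℂ) : ℂ :=
  (q'.1 * conj q.1 + conj q'.2 * q.2) / ((normSq q.1 + normSq q.2 : ℝ) : ℂ)

theorem normSq_add_normSq_pos {q : ℂ × ℂ} (hq : hopf q ≠ 0) : 0 < normSq q.1 + normSq q.2 := by
  have h1 := normSq_nonneg q.1
  have h2 := normSq_nonneg q.2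
  refine lt_of_le_of_ne (by positivity) fun h => hq ?_
  have e1 : q.1 = 0 := normSq_eq_zero.1 (by linarith)
  have e2 : q.2 = 0 := normSq_eq_zero.1 (by linarith)
  simp [hopf, e1, e2]

theorem hopfRatio_rotHopf (a : Circle) {q : ℂ × ℂ} (hq : hopf q ≠ 0) :
    hopfRatio (rotHopf a q) q = a := by
  have h := (normSq_add_normSq_pos hq).ne'
  have h' : ((normSq q.1 + normSq q.2 : ℝ) : ℂ) ≠ 0 := by exact_mod_cast h
  rw [hopfRatio, div_eq_iff h', rotHopf, Circle.coe_inv_eq_conj]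
  push_cast
  rw [← mul_conj, ← mul_conj, map_mul, conj_conj]
  ring

theorem hopf_sq (q : ℂ × ℂ) :
    (normSq q.1 + normSq q.2) ^ 2 = (hopf q).2 ^ 2 + 4 * normSq (hopf q).1 := by
  simp only [hopf, normSq_mul]
  ring

theorem hopf_fst_snd (q : ℂ × ℂ) :
    normSq q.1 = (√((hopf q).2 ^ 2 + 4 * normSq (hopf q).1) + (hopf q).2) / 2 ∧
    normSq q.2 = (√((hopf q).2 ^ 2 + 4 * normSq (hopf q).1) - (hopf q).2) / 2 := by
  rw [← hopf_sq, Real.sqrt_sq (add_nonneg (normSq_nonneg _) (normSq_nonneg _))]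
  constructor <;> simp only [hopf] <;> ring

theorem exists_rotHopf {q q' : ℂ × ℂ} (h : hopf q' = hopf q) : ∃ a : Circle, q' = rotHopf a q := by
  have h1 : normSq q'.1 = normSq q.1 := by rw [(hopf_fst_snd q').1, (hopf_fst_snd q).1, h]
  have h2 : normSq q'.2 = normSq q.2 := by rw [(hopf_fst_snd q').2, (hopf_fst_snd q).2, h]
  have h3 : q'.1 * q'.2 = q.1 * q.2 := congrArg Prod.fst h
  have key : ∀ z z' : ℂ, normSq z' = normSq z → z ≠ 0 → ∃ a : Circle, (a : ℂ) = z' / z := by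
    intro z z' hz hz0
    refine ⟨⟨z' / z, mem_sphere_zero_iff_norm.2 ?_⟩, rfl⟩
    rw [← sq_eq_sq₀ (norm_nonneg _) zero_le_one, ← normSq_eq_norm_sq, normSq_div, hz,
      div_self (fun h => hz0 (normSq_eq_zero.1 h)), one_pow]
  by_cases hz : q.1 = 0
  · have hz' : q'.1 = 0 := normSq_eq_zero.1 (by rw [h1, hz, map_zero])
    by_cases hw : q.2 = 0
    · have hw' : q'.2 = 0 := normSq_eq_zero.1 (by rw [h2, hw, map_zero])
      exact ⟨1, by rw [rotHopf_one]; exact Prod.ext (hz'.trans hz.symm) (hw'.trans hw.symm)⟩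
    · obtain ⟨a, ha⟩ := key _ _ h2 hw
      refine ⟨a⁻¹, Prod.ext (by simp [rotHopf, hz, hz']) ?_⟩
      rw [rotHopf, inv_inv, ha, div_mul_cancel₀ _ hw]
  · have hz' : q'.1 ≠ 0 := fun h0 => hz (normSq_eq_zero.1 (by rw [← h1, h0, map_zero]))
    obtain ⟨a, ha⟩ := key _ _ h1 hz
    refine ⟨a, Prod.ext ?_ ?_⟩
    · rw [rotHopf, ha, div_mul_cancel₀ _ hz]
    · rw [rotHopf, Circle.coe_inv, ha]
      field_simp
      linear_combination h3

theorem rotHopf_left_injective {q : ℂ × ℂ} (hq : hopf q ≠ 0) {a b : Circle}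
    (h : rotHopf a q = rotHopf b q) : a = b := by
  apply Circle.coe_injective
  rw [← hopfRatio_rotHopf a hq, h, hopfRatio_rotHopf b hq]

theorem exists_continuous_rotHopf {X : Type*} [TopologicalSpace X] {q q' : C(X, ℂ × ℂ)}
    (h : ∀ x, hopf (q' x) = hopf (q x)) (h0 : ∀ x, hopf (q x) ≠ 0) :
    ∃ a : C(X, Circle), ∀ x, q' x = rotHopf (a x) (q x) := by
  choose a ha using fun x => exists_rotHopf (h x)
  refine ⟨⟨a, continuous_induced_rng.2 ?_⟩, ha⟩
  have e : (fun x => (a x : ℂ)) = fun x => hopfRatio (q' x) (q x) := by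
    funext x
    rw [ha x, hopfRatio_rotHopf _ (h0 x)]
  change Continuous fun x => (a x : ℂ)
  rw [e]
  unfold hopfRatio
  have hn := continuous_normSq
  refine Continuous.div (by fun_prop) (by fun_prop) fun x => ?_
  exact_mod_cast (normSq_add_normSq_pos (h0 x)).ne'

/-- The inner product of the Hermitian positive matrices representing two points of `ℂ × ℝ`. -/
def hopfInner (b b' : ℂ × ℝ) : ℝ :=
  (√(b.2 ^ 2 + 4 * normSq b.1) * √(b'.2 ^ 2 + 4 * normSq b'.1) + b.2 * b'.2) / 2 +
    2 * (b.1 * conj b'.1).re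

theorem continuous_hopfInner : Continuous fun x : (ℂ × ℝ) × (ℂ × ℝ) => hopfInner x.1 x.2 := by
  unfold hopfInner
  have := continuous_normSq
  fun_prop

theorem hopfInner_self (b : ℂ × ℝ) : hopfInner b b = b.2 ^ 2 + 4 * normSq b.1 := by
  rw [hopfInner, Real.mul_self_sqrt (by have := normSq_nonneg b.1; positivity), mul_conj, ofReal_re]
  ring

theorem hopfInner_self_pos {b : ℂ × ℝ} (hb : b ≠ 0) : 0 < hopfInner b b := by
  rw [hopfInner_self]
  have h1 := normSq_nonneg b.1
  refine lt_of_le_of_ne (by positivity) fun h => hb ?_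
  have e1 : normSq b.1 = 0 := by nlinarith [sq_nonneg b.2]
  have e2 : b.2 ^ 2 = 0 := by nlinarith [sq_nonneg b.2]
  exact Prod.ext (normSq_eq_zero.1 e1) (pow_eq_zero_iff two_ne_zero |>.1 e2)

/-- The transport from a point `q` to a fibre of the Hopf map over a nearby point `b`. -/
def hopfTransport (b : ℂ × ℝ) (q : ℂ × ℂ) : ℂ × ℂ :=
  (((√(hopfInner (hopf q) b))⁻¹ : ℝ) *
      (((√(b.2 ^ 2 + 4 * normSq b.1) + b.2) / 2 : ℝ) * q.1 + b.1 * conj q.2),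
   ((√(hopfInner (hopf q) b))⁻¹ : ℝ) *
      (b.1 * conj q.1 + ((√(b.2 ^ 2 + 4 * normSq b.1) - b.2) / 2 : ℝ) * q.2))

theorem hopfTransport_rotHopf (a : Circle) (b : ℂ × ℝ) (q : ℂ × ℂ) :
    hopfTransport b (rotHopf a q) = rotHopf a (hopfTransport b q) := by
  have e : conj (a : ℂ) = (a : ℂ)⁻¹ := by rw [← Circle.coe_inv_eq_conj, Circle.coe_inv]
  simp only [hopfTransport, hopf_rotHopf]
  simp only [rotHopf, map_mul, Circle.coe_inv, map_inv₀, e, inv_inv]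
  ext1 <;> ring

theorem hopfTransport_hopf (q : ℂ × ℂ) : hopfTransport (hopf q) q = q := by
  have e1 := (hopf_fst_snd q).1
  have e2 := (hopf_fst_snd q).2
  have e3 : hopfInner (hopf q) (hopf q) = (normSq q.1 + normSq q.2) ^ 2 := by
    rw [hopfInner_self, hopf_sq]
  by_cases hq : hopf q = 0
  · have e4 := hopf_sq q
    rw [hq] at e4
    simp only [Prod.snd_zero, Prod.fst_zero, map_zero] at e4
    have e5 : normSq q.1 + normSq q.2 = 0 := by
      exact pow_eq_zero_iff two_ne_zero |>.1 (by linarith)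
    have h1 : q.1 = 0 := normSq_eq_zero.1 (by linarith [normSq_nonneg q.1, normSq_nonneg q.2])
    have h2 : q.2 = 0 := normSq_eq_zero.1 (by linarith [normSq_nonneg q.1, normSq_nonneg q.2])
    ext1 <;> simp [hopfTransport, h1, h2]
  · have h := normSq_add_normSq_pos hq
    have h' : ((normSq q.1 + normSq q.2 : ℝ) : ℂ) ≠ 0 := by exact_mod_cast h.ne'
    rw [hopfTransport, e3, Real.sqrt_sq h.le, ← e1, ← e2, ofReal_inv]
    push_cast at h' ⊢
    simp only [← mul_conj] at h' ⊢
    ext1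
    · simp only [hopf]
      rw [inv_mul_eq_iff_eq_mul₀ h']
      ring
    · simp only [hopf]
      rw [inv_mul_eq_iff_eq_mul₀ h']
      ring

theorem hopf_hopfTransport {b : ℂ × ℝ} {q : ℂ × ℂ} (h : 0 < hopfInner (hopf q) b) :
    hopf (hopfTransport b q) = b := by
  have e1 := (hopf_fst_snd q).1
  have e2 := (hopf_fst_snd q).2
  set r := √((hopf q).2 ^ 2 + 4 * normSq (hopf q).1) with hr
  have hD : hopfInner (hopf q) b = normSq q.1 * ((√(b.2 ^ 2 + 4 * normSq b.1) + b.2) / 2) +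
      normSq q.2 * ((√(b.2 ^ 2 + 4 * normSq b.1) - b.2) / 2) +
      2 * (q.1 * q.2 * conj b.1).re := by
    rw [hopfInner, ← hr, e1, e2]
    simp only [hopf]
    ring
  have hAB : ((√(b.2 ^ 2 + 4 * normSq b.1) + b.2) / 2) *
      ((√(b.2 ^ 2 + 4 * normSq b.1) - b.2) / 2) = normSq b.1 := by
    have := Real.sq_sqrt (show 0 ≤ b.2 ^ 2 + 4 * normSq b.1 by
      have := normSq_nonneg b.1; positivity)
    linear_combination this / 4
  have hx : b.2 = ((√(b.2 ^ 2 + 4 * normSq b.1) + b.2) / 2) -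
      ((√(b.2 ^ 2 + 4 * normSq b.1) - b.2) / 2) := by ring
  unfold hopfTransport
  generalize (√(b.2 ^ 2 + 4 * normSq b.1) + b.2) / 2 = A at *
  generalize (√(b.2 ^ 2 + 4 * normSq b.1) - b.2) / 2 = B at *
  have hs := Real.sq_sqrt h.le
  have hs0 := (Real.sqrt_pos.2 h).ne'
  set d := √(hopfInner (hopf q) b) with hd
  rw [hD] at hs
  obtain ⟨⟨u1, u2⟩, x⟩ := b
  obtain ⟨⟨z1, z2⟩, ⟨w1, w2⟩⟩ := q
  simp only [normSq_mk] at hAB hs hx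
  clear_value d
  clear hr hD e1 e2 r hd h
  simp only [mul_re, mul_im, conj_re, conj_im] at hs
  rw [hx]
  simp only [hopf]
  ext1
  · apply Complex.ext
    · simp
      field_simp
      linear_combination (z1 * w1 - z2 * w2) * hAB - u1 * hs
    · simp
      field_simp
      linear_combination (z1 * w2 + z2 * w1) * hAB - u2 * hs
  · simp [normSq_apply]
    field_simp
    linear_combination ((z1 ^ 2 + z2 ^ 2) - (w1 ^ 2 + w2 ^ 2)) * hAB - (A - B) * hs

end Hopf

/-- Homotopy lifting for the Hopf map, compatible with the circle action. -/
theorem exists_hopf_lift {K : Type*} [TopologicalSpace K] [CompactSpace K]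
    (F : C(unitInterval × K, ℂ × ℝ)) (hF : ∀ x, F x ≠ 0) (q₀ : C(K, ℂ × ℂ))
    (hq₀ : ∀ k, hopf (q₀ k) = F (0, k)) :
    ∃ G : C(unitInterval × K, ℂ × ℂ), (∀ x, hopf (G x) = F x) ∧ (∀ k, G (0, k) = q₀ k) ∧
      (∀ k, (∀ t, F (t, k) = F (0, k)) → ∀ t, G (t, k) = q₀ k) ∧
      ∀ a : Circle, ∀ k k', (∀ t, F (t, k) = F (t, k')) → q₀ k = rotHopf a (q₀ k') →
        ∀ t, G (t, k) = rotHopf a (G (t, k')) := by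
  have hU : IsOpen {x : (ℂ × ℝ) × (ℂ × ℝ) | 0 < hopfInner x.1 x.2} :=
    isOpen_lt continuous_const continuous_hopfInner
  have hT : ContinuousOn (fun x : (ℂ × ℝ) × (ℂ × ℂ) => hopfTransport x.1 x.2)
      {x | x.2 ∈ Set.univ ∧ 0 < hopfInner (hopf x.2) x.1} := by
    have h1 : ContinuousOn (fun x : (ℂ × ℝ) × (ℂ × ℂ) =>
        (((√(hopfInner (hopf x.2) x.1))⁻¹ : ℝ) : ℂ))
        {x | x.2 ∈ Set.univ ∧ 0 < hopfInner (hopf x.2) x.1} := by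
      refine Complex.continuous_ofReal.comp_continuousOn (ContinuousOn.inv₀ ?_ fun x hx => ?_)
      · exact (Real.continuous_sqrt.comp (continuous_hopfInner.comp
          ((continuous_hopf.comp continuous_snd).prodMk continuous_fst))).continuousOn
      · exact (Real.sqrt_pos.2 hx.2).ne'
    have hn := Complex.continuous_normSq
    unfold hopfTransport
    refine ContinuousOn.prodMk (h1.mul ?_) (h1.mul ?_) <;>
    exact Continuous.continuousOn (by fun_prop)
  obtain ⟨G, hG, hG0, hGr, hGg⟩ := exists_transport_lift (K := K) hopf (S := Set.univ) hU
    hopfTransport hT (fun b e _ h => ⟨trivial, hopf_hopfTransport h⟩)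
    (fun e _ => hopfTransport_hopf e) F (fun x => hopfInner_self_pos (hF x)) q₀
    (fun k => ⟨trivial, hq₀ k⟩)
  exact ⟨G, fun x => (hG x).2, hG0, hGr, fun a => hGg (rotHopf a)
    fun b e _ _ => hopfTransport_rotHopf a b e⟩

/-! ### The degree of a map from the square to the complement of the origin -/

/-- The circle-valued function on the boundary of the square that winds `n` times along the side
where the first coordinate is `1`. -/
def sideWinding (n : ℤ) (s : Sq) : Circle :=
  if s 0 = 1 then Circle.exp (2 * Real.pi * n * s 1) else 1

theorem sideWinding_zero (s : Sq) : sideWinding 0 s = 1 := by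
  simp [sideWinding]

theorem sideWinding_of_ne (n : ℤ) {s : Sq} (hs : s 0 ≠ 1) : sideWinding n s = 1 := if_neg hs

theorem sideWinding_of_eq (n : ℤ) {s : Sq} (hs : s 0 = 1) :
    sideWinding n s = Circle.exp (2 * Real.pi * n * s 1) := if_pos hs

theorem exp_winding_of_side (n : ℤ) {t : unitInterval} (ht : t = 0 ∨ t = 1) :
    Circle.exp (2 * Real.pi * n * t) = 1 := by
  rcases ht with rfl | rfl
  · simp
  · rw [Set.Icc.coe_one, mul_one, Circle.exp_two_pi_mul_int]

theorem sideWinding_of_side (n : ℤ) {s : Sq} (hs : s 1 = 0 ∨ s 1 = 1) : sideWinding n s = 1 := by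
  rw [sideWinding, exp_winding_of_side n hs, ite_self]

/-- The map `f : [0,1]² → (ℂ × ℝ) ∖ 0`, constant on the boundary, has degree `n`: it lifts along
the Hopf map to a map that winds `n` times around a fibre on the boundary. -/
def HopfDeg (f : C(Sq, ℂ × ℝ)) (n : ℤ) : Prop :=
  ∃ q : C(Sq, ℂ × ℂ), (∀ s, hopf (q s) = f s) ∧
    ∀ s ∈ Cube.boundary (Fin 2), q s = rotHopf (sideWinding n s) (q 0)

theorem hopfDeg_zero_iff {f : C(Sq, ℂ × ℝ)} :
    HopfDeg f 0 ↔ ∃ q : C(Sq, ℂ × ℂ), (∀ s, hopf (q s) = f s) ∧ ConstOnBoundary q := by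
  constructor
  · rintro ⟨q, hq, h⟩
    exact ⟨q, hq, fun s hs s' hs' => by rw [h s hs, h s' hs', sideWinding_zero, sideWinding_zero]⟩
  · rintro ⟨q, hq, h⟩
    exact ⟨q, hq, fun s hs => by
      rw [sideWinding_zero, rotHopf_one, h s hs 0 Sq.zero_mem_boundary]⟩

theorem hopfDeg_const (c : ℂ × ℝ) : HopfDeg (ContinuousMap.const _ c) 0 := by
  obtain ⟨q, hq⟩ := hopf_surjective c
  exact hopfDeg_zero_iff.2 ⟨ContinuousMap.const _ q, fun _ => hq, fun _ _ _ _ => rfl⟩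

theorem HopfDeg.exists {f : C(Sq, ℂ × ℝ)} (hb : ConstOnBoundary f) (h0 : ∀ s, f s ≠ 0) :
    ∃ n, HopfDeg f n := by
  obtain ⟨q₀, hq₀⟩ := hopf_surjective (f 0)
  have hbd : ∀ s : Sq, (∃ i, s i = 0 ∨ s i = 1) → f s = f 0 := fun s hs =>
    hb s hs 0 Sq.zero_mem_boundary
  let F : C(unitInterval × unitInterval, ℂ × ℝ) := f.comp ⟨fun x => ![x.2, x.1], by
    refine continuous_pi fun i => ?_
    fin_cases i
    · exact continuous_snd
    · exact continuous_fst⟩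
  have hF : ∀ t k, F (t, k) = f ![k, t] := fun _ _ => rfl
  have hF0 : ∀ k, F (0, k) = f 0 := fun k => hbd _ ⟨1, Or.inl rfl⟩
  have hF1 : ∀ k, F (1, k) = f 0 := fun k => hbd _ ⟨1, Or.inr rfl⟩
  obtain ⟨G, hG, hG0, hGr, -⟩ := exists_hopf_lift F (fun x => h0 _) (ContinuousMap.const _ q₀)
    (fun k => hq₀.trans (hF0 k).symm)
  have hs0 : ∀ t, G (t, 0) = q₀ := hGr 0 fun t =>
    (hbd ![0, t] ⟨0, Or.inl rfl⟩).trans (hF0 0).symm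
  have hs1 : ∀ t, G (t, 1) = q₀ := hGr 1 fun t =>
    (hbd ![1, t] ⟨0, Or.inr rfl⟩).trans (hF0 1).symm
  have hq₀' : hopf q₀ ≠ 0 := hq₀ ▸ h0 0
  obtain ⟨ν, hν⟩ := exists_continuous_rotHopf (q := ContinuousMap.const unitInterval q₀)
    (q' := G.comp ⟨fun k => (1, k), by fun_prop⟩)
    (fun k => (hG (1, k)).trans ((hF1 k).trans hq₀.symm)) (fun k => hq₀')
  have hν' : ∀ k, G (1, k) = rotHopf (ν k) q₀ := hν
  have hν0 : ν 0 = 1 := rotHopf_left_injective hq₀' <| by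
    rw [← hν', hs0, rotHopf_one]
  have hν1 : ν 1 = 1 := rotHopf_left_injective hq₀' <| by
    rw [← hν', hs1, rotHopf_one]
  obtain ⟨θ, hθ0, hθ⟩ := exists_angle_unitInterval ν (θ₀ := 0) (by simp [hν0])
  obtain ⟨m, hm⟩ := Circle.exp_eq_one.1 ((hθ 1).trans hν1)
  let q : C(Sq, ℂ × ℂ) := ⟨fun s => rotHopf (Circle.exp (-((s 1 : ℝ) * θ (s 0)))) (G (s 1, s 0)), by
    refine Continuous.rotHopf (Circle.exp.continuous.comp ?_) ?_ <;> fun_prop⟩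
  have hq : ∀ s, q s = rotHopf (Circle.exp (-((s 1 : ℝ) * θ (s 0)))) (G (s 1, s 0)) :=
    fun _ => rfl
  have hq0 : q 0 = q₀ := by simp [hq, hs0]
  refine ⟨-m, q, fun s => ?_, fun s hs => ?_⟩
  · rw [hq, hopf_rotHopf, hG, hF]
    congr 1
    ext i
    fin_cases i <;> rfl
  · rw [hq0, hq]
    obtain ⟨i, hi⟩ := hs
    fin_cases i
    · rcases hi with hi | hi
      · change s 0 = 0 at hi
        rw [sideWinding_of_ne _ (by simp [hi]), hi, hs0, hθ0]
        simp
      · change s 0 = 1 at hi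
        rw [sideWinding_of_eq _ hi, hi, hs1, hm]
        congr 2
        push_cast
        ring
    · change s 1 = 0 ∨ s 1 = 1 at hi
      rw [sideWinding_of_side _ hi]
      rcases hi with hi | hi
      · rw [hi, hG0]
        simp
      · rw [hi, hν', rotHopf_rotHopf, ← hθ, ← Circle.exp_add]
        simp

theorem HopfDeg.unique {f : C(Sq, ℂ × ℝ)} (h0 : ∀ s, f s ≠ 0) {n m : ℤ} (hn : HopfDeg f n)
    (hm : HopfDeg f m) : n = m := by
  obtain ⟨q, hq, hqb⟩ := hn
  obtain ⟨q', hq', hqb'⟩ := hm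
  have hh : ∀ s, hopf (q s) ≠ 0 := fun s => (hq s).symm ▸ h0 s
  obtain ⟨a, ha⟩ := exists_continuous_rotHopf (q := q) (q' := q')
    (fun s => (hq' s).trans (hq s).symm) hh
  have hab : ∀ s ∈ Cube.boundary (Fin 2),
      a s * sideWinding n s = sideWinding m s * a 0 := fun s hs =>
    rotHopf_left_injective (hh 0) <| by
      rw [← rotHopf_rotHopf, ← hqb s hs, ← ha, hqb' s hs, ha 0, rotHopf_rotHopf]
  obtain ⟨θ, hθ⟩ := exists_angle_Sq a
  let p : C(unitInterval × unitInterval, Sq) := ⟨fun x => ![x.1, x.2], by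
    refine continuous_pi fun i => ?_
    fin_cases i
    · exact continuous_fst
    · exact continuous_snd⟩
  have hside : ∀ t₁ : unitInterval, t₁ = 0 ∨ t₁ = 1 → θ (p (1, t₁)) = θ (p (0, t₁)) := by
    intro t₁ ht₁
    refine Circle.isCoveringMap_exp.const_of_comp (g := fun t => θ (p (t, t₁))) (by fun_prop)
      (fun t t' => ?_) 1 0
    have e : ∀ t, a (p (t, t₁)) = a 0 := fun t => by
      have := hab (p (t, t₁)) ⟨1, ht₁⟩
      rwa [sideWinding_of_side _ ht₁, sideWinding_of_side _ ht₁, mul_one, one_mul] at this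
    simp only [hθ, e]
  have hleft : θ (p (0, 1)) = θ (p (0, 0)) := by
    refine Circle.isCoveringMap_exp.const_of_comp (g := fun t => θ (p (0, t))) (by fun_prop)
      (fun t t' => ?_) 1 0
    have e : ∀ t, a (p (0, t)) = a 0 := fun t => by
      have := hab (p (0, t)) ⟨0, Or.inl rfl⟩
      rwa [sideWinding_of_ne _ (by simp [p]), sideWinding_of_ne _ (by simp [p]), mul_one,
        one_mul] at this
    simp only [hθ, e]
  have hright := Circle.isCoveringMap_exp.const_of_comp
    (g := fun t : unitInterval => θ (p (1, t)) + 2 * Real.pi * n * t - 2 * Real.pi * m * t)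
    (by fun_prop) (fun t t' => ?_) 1 0
  · rw [hside 1 (Or.inr rfl), hleft, hside 0 (Or.inl rfl)] at hright
    simp only [Set.Icc.coe_one, Set.Icc.coe_zero, mul_one, mul_zero] at hright
    have : 2 * Real.pi * ((n : ℝ) - m) = 0 := by linear_combination hright
    have hpi := Real.pi_ne_zero
    have h : (n : ℝ) - m = 0 := by
      simpa [hpi] using this
    exact_mod_cast sub_eq_zero.1 h
  · have e : ∀ t : unitInterval,
        Circle.exp (θ (p (1, t)) + 2 * Real.pi * n * t - 2 * Real.pi * m * t) = a 0 := fun t => by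
      have := hab (p (1, t)) ⟨0, Or.inr rfl⟩
      rw [sideWinding_of_eq _ rfl, sideWinding_of_eq _ rfl] at this
      change a (p (1, t)) * Circle.exp (2 * Real.pi * n * t) =
        Circle.exp (2 * Real.pi * m * t) * a 0 at this
      rw [Circle.exp_sub, Circle.exp_add, hθ, this, mul_comm, mul_div_cancel_right]
    simp only [e]

theorem HopfDeg.of_freelyHomotopicIn {f g : C(Sq, ℂ × ℝ)} (H : FreelyHomotopicIn {0}ᶜ f g) {n : ℤ}
    (hf : HopfDeg f n) : HopfDeg g n := by
  obtain ⟨F, F0, F1, hb, hS⟩ := FreelyHomotopicIn.iff_exists.1 H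
  obtain ⟨q, hq, hqb⟩ := hf
  obtain ⟨G, hG, hG0, -, hGg⟩ := exists_hopf_lift F hS q fun s => (hq s).trans (F0 s).symm
  refine ⟨G.comp ⟨fun s => (1, s), by fun_prop⟩, fun s => (hG _).trans (F1 s), fun s hs => ?_⟩
  exact hGg _ s 0 (fun t => hb t s hs 0 Sq.zero_mem_boundary) (hqb s hs) 1

theorem HopfDeg.glue {f f₁ f₂ : C(Sq, ℂ × ℝ)} (h : f₁ 0 = f₂ 0)
    (hf : ∀ s, f s = if (s 0 : ℝ) ≤ 1 / 2
      then f₁ (Function.update s 0 (Set.projIcc 0 1 zero_le_one (2 * (s 0 : ℝ))))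
      else f₂ (Function.update s 0 (Set.projIcc 0 1 zero_le_one (2 * (s 0 : ℝ) - 1))))
    {n m : ℤ} (h₁ : HopfDeg f₁ n) (h₂ : HopfDeg f₂ m) : HopfDeg f (n + m) := by
  obtain ⟨q₁, hq₁, hb₁⟩ := h₁
  obtain ⟨q₂, hq₂, hb₂⟩ := h₂
  obtain ⟨a, ha⟩ := exists_rotHopf (q := q₂ 0) (q' := q₁ 0) (by rw [hq₁, hq₂, h])
  have hb₂' : ∀ s ∈ Cube.boundary (Fin 2),
      rotHopf a (q₂ s) = rotHopf (sideWinding m s) (q₁ 0) := fun s hs => by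
    rw [hb₂ s hs, ha, rotHopf_rotHopf, rotHopf_rotHopf, mul_comm]
  let l : Sq → Sq := fun s => Function.update s 0 (Set.projIcc 0 1 zero_le_one (2 * (s 0 : ℝ)))
  let r : Sq → Sq := fun s => Function.update s 0 (Set.projIcc 0 1 zero_le_one (2 * (s 0 : ℝ) - 1))
  have hl : Continuous l := continuous_id.update 0 (continuous_projIcc.comp (by fun_prop))
  have hr : Continuous r := continuous_id.update 0 (continuous_projIcc.comp (by fun_prop))
  have hl1 : ∀ s, l s 1 = s 1 := fun s => Function.update_of_ne (by decide) _ _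
  have hr1 : ∀ s, r s 1 = s 1 := fun s => Function.update_of_ne (by decide) _ _
  have hl0 : ∀ s, l s 0 = Set.projIcc 0 1 zero_le_one (2 * (s 0 : ℝ)) := fun s =>
    Function.update_self _ _ _
  have hr0 : ∀ s, r s 0 = Set.projIcc 0 1 zero_le_one (2 * (s 0 : ℝ) - 1) := fun s =>
    Function.update_self _ _ _
  let Q : Sq → ℂ × ℂ := fun s => if (s 0 : ℝ) ≤ 1 / 2 then q₁ (l s) else
    rotHopf (Circle.exp (2 * Real.pi * n * s 1)) (rotHopf a (q₂ (r s)))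
  have hQc : Continuous Q := by
    refine Continuous.if_le (q₁.continuous.comp hl) (Continuous.rotHopf
      (Circle.exp.continuous.comp (by fun_prop)) (continuous_const.rotHopf (q₂.continuous.comp hr)))
      (by fun_prop) continuous_const fun s hs => ?_
    have el : l s 0 = 1 := by
      rw [hl0, hs]
      exact Set.projIcc_of_right_le _ (by norm_num)
    have er : r s 0 = 0 := by
      rw [hr0, hs]
      exact Set.projIcc_of_le_left _ (by norm_num)
    rw [hb₁ _ ⟨0, Or.inr el⟩, hb₂' _ ⟨0, Or.inl er⟩, sideWinding_of_eq _ el,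
      sideWinding_of_ne _ (by simp [er]), rotHopf_one, hl1]
  have hQ0 : Q 0 = q₁ 0 := by
    have e : l 0 0 = 0 := by
      rw [hl0]
      exact Set.projIcc_of_le_left _ (by simp)
    have : Q 0 = q₁ (l 0) := if_pos (by simp)
    rw [this, hb₁ _ ⟨0, Or.inl e⟩, sideWinding_of_ne _ (by simp [e]), rotHopf_one]
  refine ⟨⟨Q, hQc⟩, fun s => ?_, fun s hs => ?_⟩
  · change hopf (if _ then _ else _) = _
    rw [hf]
    split_ifs
    · exact hq₁ _
    · rw [hopf_rotHopf, hopf_rotHopf]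
      exact hq₂ _
  · change Q s = rotHopf _ (Q 0)
    rw [hQ0]
    obtain ⟨i, hi⟩ := hs
    fin_cases i
    · rcases hi with hi | hi
      · change s 0 = 0 at hi
        have e : l s 0 = 0 := by
          rw [hl0, hi]
          exact Set.projIcc_of_le_left _ (by simp)
        have : Q s = q₁ (l s) := if_pos (by simp [hi])
        rw [this, hb₁ _ ⟨0, Or.inl e⟩, sideWinding_of_ne _ (by simp [e]),
          sideWinding_of_ne _ (by simp [hi])]
      · change s 0 = 1 at hi
        have e : r s 0 = 1 := by
          rw [hr0, hi]
          exact Set.projIcc_of_right_le _ (by norm_num)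
        have : Q s = rotHopf (Circle.exp (2 * Real.pi * n * s 1)) (rotHopf a (q₂ (r s))) :=
          if_neg (by norm_num [hi])
        rw [this, hb₂' _ ⟨0, Or.inr e⟩, sideWinding_of_eq _ e, sideWinding_of_eq _ hi,
          rotHopf_rotHopf, hr1, ← Circle.exp_add]
        congr 2
        push_cast
        ring
    · change s 1 = 0 ∨ s 1 = 1 at hi
      rw [sideWinding_of_side _ hi, rotHopf_one]
      change (if _ then _ else _) = _
      split_ifs
      · rw [hb₁ _ ⟨1, by rwa [hl1]⟩, sideWinding_of_side _ (by rwa [hl1]), rotHopf_one]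
      · rw [hb₂' _ ⟨1, by rwa [hr1]⟩, sideWinding_of_side _ (by rwa [hr1]), rotHopf_one,
          exp_winding_of_side n hi, rotHopf_one]

/-- A map of degree one. -/
theorem exists_hopfDeg_one : ∃ f : C(Sq, ℂ × ℝ), ConstOnBoundary f ∧ (∀ s, f s ≠ 0) ∧
    (∀ s, (f s).2 ≤ 1) ∧ HopfDeg f 1 := by
  let α : Sq → ℂ := fun s => (1 - (s 0 : ℝ) : ℝ) + (s 0 : ℝ) * (Circle.exp (2 * Real.pi * s 1) : ℂ)
  let β : Sq → ℂ := fun s => ((s 0 : ℝ) * (1 - s 0) * (s 1 * (1 - s 1)) : ℝ)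
  have hα : Continuous α := by
    have : Continuous fun s : Sq => (Circle.exp (2 * Real.pi * s 1) : ℂ) :=
      Circle.continuous_coe.comp (Circle.exp.continuous.comp (by fun_prop))
    fun_prop
  have hβ : Continuous β := by fun_prop
  have hαb : ∀ s ∈ Cube.boundary (Fin 2), α s = sideWinding 1 s := by
    rintro s ⟨i, hi⟩
    fin_cases i
    · rcases hi with hi | hi
      · change s 0 = 0 at hi
        simp [α, hi, sideWinding]
      · change s 0 = 1 at hi
        simp [α, hi, sideWinding]
    · change s 1 = 0 ∨ s 1 = 1 at hi
      have h1 := exp_winding_of_side 1 hi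
      rw [Int.cast_one, mul_one] at h1
      rw [sideWinding_of_side _ hi]
      change ((1 - (s 0 : ℝ) : ℝ) : ℂ) + (s 0 : ℝ) * (Circle.exp (2 * Real.pi * s 1) : ℂ) = _
      rw [h1]
      simp
  have hβb : ∀ s ∈ Cube.boundary (Fin 2), β s = 0 := by
    rintro s ⟨i, hi⟩
    fin_cases i
    · rcases hi with hi | hi
      · change s 0 = 0 at hi
        simp [β, hi]
      · change s 0 = 1 at hi
        simp [β, hi]
    · rcases hi with hi | hi
      · change s 1 = 0 at hi
        simp [β, hi]
      · change s 1 = 1 at hi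
        simp [β, hi]
  have hα1 : ∀ s, ‖α s‖ ≤ 1 := fun s => by
    refine (norm_add_le _ _).trans ?_
    rw [norm_mul, Circle.norm_coe, Complex.norm_real, Complex.norm_real, Real.norm_of_nonneg
      (by linarith [(s 0).2.2]), Real.norm_of_nonneg (s 0).2.1]
    linarith
  let q : C(Sq, ℂ × ℂ) := ⟨fun s => (α s, β s), hα.prodMk hβ⟩
  have hqb : ∀ s ∈ Cube.boundary (Fin 2), q s = rotHopf (sideWinding 1 s) (1, 0) := fun s hs =>
    Prod.ext (by simp [q, rotHopf, hαb s hs]) (by simp [q, rotHopf, hβb s hs])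
  have hq0 : q 0 = (1, 0) := by
    rw [hqb 0 Sq.zero_mem_boundary, sideWinding_of_ne _ (by simp), rotHopf_one]
  refine ⟨⟨fun s => hopf (q s), continuous_hopf.comp q.continuous⟩, fun s hs s' hs' => ?_,
    fun s => ?_, fun s => ?_, q, fun _ => rfl, fun s hs => ?_⟩
  · change hopf (q s) = hopf (q s')
    rw [hqb s hs, hqb s' hs', hopf_rotHopf, hopf_rotHopf]
  · change hopf (q s) ≠ 0
    by_cases hs : s ∈ Cube.boundary (Fin 2)
    · rw [hqb s hs, hopf_rotHopf]
      simp [hopf]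
    · intro h
      have h1 := hopf_sq (q s)
      rw [h] at h1
      have h2 := Complex.normSq_nonneg (q s).1
      have h3 := Complex.normSq_nonneg (q s).2
      have h4 : Complex.normSq (q s).2 = 0 := by
        have : Complex.normSq (q s).1 + Complex.normSq (q s).2 = 0 :=
          pow_eq_zero_iff two_ne_zero |>.1 (by simpa using h1)
        linarith
      have h5 : ((s 0 : ℝ) * (1 - s 0) * (s 1 * (1 - s 1)) : ℝ) = 0 := by
        have : (β s : ℂ) = 0 := Complex.normSq_eq_zero.1 h4
        exact Complex.ofReal_eq_zero.1 this
      refine hs ?_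
      rcases mul_eq_zero.1 h5 with h | h <;> rcases mul_eq_zero.1 h with h | h
      · exact ⟨0, Or.inl (Subtype.ext h)⟩
      · exact ⟨0, Or.inr (Subtype.ext (sub_eq_zero.1 h).symm)⟩
      · exact ⟨1, Or.inl (Subtype.ext h)⟩
      · exact ⟨1, Or.inr (Subtype.ext (sub_eq_zero.1 h).symm)⟩
  · change Complex.normSq (α s) - Complex.normSq (β s) ≤ 1
    have h1 := Complex.normSq_nonneg (β s)
    have h2 := hα1 s
    rw [Complex.normSq_eq_norm_sq (α s)]
    nlinarith [norm_nonneg (α s)]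
  · rw [hq0, hqb s hs]

/-! ### Null-homotopies in the complement of subspaces of codimension at least four -/

section Codimension

variable {V : Type*} [NormedAddCommGroup V] [NormedSpace ℝ V] [FiniteDimensional ℝ V]

theorem exists_contDiff_near_real (f : C(Sq, ℝ)) {ε : ℝ} (hε : 0 < ε) :
    ∃ F : ℝ × ℝ → ℝ, ContDiff ℝ 1 F ∧ ∀ s : Sq, ‖F (s 0, s 1) - f s‖ < ε := by
  let A : Subalgebra ℝ C(Sq, ℝ) :=
    { carrier := {f | ∃ F : ℝ × ℝ → ℝ, ContDiff ℝ 1 F ∧ ∀ s : Sq, F (s 0, s 1) = f s}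
      mul_mem' := by
        rintro f g ⟨F, hF, hf⟩ ⟨G, hG, hg⟩
        exact ⟨fun x => F x * G x, hF.mul hG, fun s => by simp [hf, hg]⟩
      add_mem' := by
        rintro f g ⟨F, hF, hf⟩ ⟨G, hG, hg⟩
        exact ⟨fun x => F x + G x, hF.add hG, fun s => by simp [hf, hg]⟩
      algebraMap_mem' := fun r => ⟨fun _ => r, contDiff_const, fun s => rfl⟩ }
  have hA : A.SeparatesPoints := by
    intro s s' hs
    obtain ⟨i, hi⟩ := Function.ne_iff.1 hs
    have hi' : (s i : ℝ) ≠ s' i := fun h => hi (Subtype.ext h)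
    refine ⟨fun s => (s i : ℝ), ⟨⟨fun s => (s i : ℝ), by fun_prop⟩, ?_, rfl⟩, hi'⟩
    fin_cases i
    · exact ⟨Prod.fst, contDiff_fst, fun s => rfl⟩
    · exact ⟨Prod.snd, contDiff_snd, fun s => rfl⟩
  obtain ⟨⟨g, G, hG, hg⟩, h⟩ :=
    ContinuousMap.exists_mem_subalgebra_near_continuousMap_of_separatesPoints A hA f ε hε
  exact ⟨G, hG, fun s => hg s ▸ (ContinuousMap.norm_lt_iff _ hε).1 h s⟩

theorem exists_contDiff_near (f : C(Sq, V)) {ε : ℝ} (hε : 0 < ε) :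
    ∃ F : ℝ × ℝ → V, ContDiff ℝ 1 F ∧ ∀ s : Sq, ‖F (s 0, s 1) - f s‖ < ε := by
  let e : V ≃L[ℝ] (Fin (Module.finrank ℝ V) → ℝ) :=
    ContinuousLinearEquiv.ofFinrankEq (by simp)
  let L : (Fin (Module.finrank ℝ V) → ℝ) →L[ℝ] V := e.symm
  have hL : 0 < ‖L‖ + 1 := by positivity
  choose F hF hFf using fun i => exists_contDiff_near_real
    (⟨fun s => e (f s) i, by fun_prop⟩ : C(Sq, ℝ)) (div_pos hε hL)
  refine ⟨fun x => L fun i => F i x, L.contDiff.comp (contDiff_pi.2 hF), fun s => ?_⟩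
  have h1 : L (fun i => F i (s 0, s 1)) - f s = L fun i => F i (s 0, s 1) - e (f s) i := by
    have h2 : f s = L (e (f s)) := (e.symm_apply_apply _).symm
    rw [h2, ← map_sub, ← h2]
    rfl
  rw [h1]
  refine (L.le_opNorm _).trans_lt ?_
  have h3 : ‖fun i => F i (s 0, s 1) - e (f s) i‖ ≤ ε / (‖L‖ + 1) :=
    (pi_norm_le_iff_of_nonneg (by positivity)).2 fun i => (hFf i s).le
  calc ‖L‖ * _ ≤ ‖L‖ * (ε / (‖L‖ + 1)) := by gcongr
    _ < (‖L‖ + 1) * (ε / (‖L‖ + 1)) := by gcongr; linarith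
    _ = ε := by field_simp

/-- A smooth function on the plane vanishing on the boundary of the unit square and equal to `1` on
the middle square. -/
def smoothCollar (x : ℝ × ℝ) : ℝ :=
  Real.smoothTransition (4 * x.1) * Real.smoothTransition (4 * (1 - x.1)) *
    (Real.smoothTransition (4 * x.2) * Real.smoothTransition (4 * (1 - x.2)))

theorem contDiff_smoothCollar : ContDiff ℝ 1 smoothCollar := by
  have h : ContDiff ℝ 1 Real.smoothTransition := Real.smoothTransition.contDiff
  unfold smoothCollar
  refine ((h.comp ?_).mul (h.comp ?_)).mul ((h.comp ?_).mul (h.comp ?_)) <;> fun_prop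

theorem smoothCollar_mem_Icc (x : ℝ × ℝ) : smoothCollar x ∈ Set.Icc 0 1 := by
  have h0 := Real.smoothTransition.nonneg
  have h1 := Real.smoothTransition.le_one
  exact ⟨mul_nonneg (mul_nonneg (h0 _) (h0 _)) (mul_nonneg (h0 _) (h0 _)),
    mul_le_one₀ (mul_le_one₀ (h1 _) (h0 _) (h1 _)) (mul_nonneg (h0 _) (h0 _))
      (mul_le_one₀ (h1 _) (h0 _) (h1 _))⟩

theorem smoothCollar_of_mem_boundary {s : Sq} (hs : s ∈ Cube.boundary (Fin 2)) :
    smoothCollar (s 0, s 1) = 0 := by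
  have h : Real.smoothTransition 0 = 0 := Real.smoothTransition.zero_of_nonpos le_rfl
  obtain ⟨i, hi⟩ := hs
  fin_cases i
  · rcases hi with hi | hi
    · change s 0 = 0 at hi
      simp [smoothCollar, hi]
    · change s 0 = 1 at hi
      simp [smoothCollar, hi]
  · rcases hi with hi | hi
    · change s 1 = 0 at hi
      simp [smoothCollar, hi]
    · change s 1 = 1 at hi
      simp [smoothCollar, hi]

theorem smoothCollar_eq_one {s : Sq} (hs : ∀ i, 1 / 4 ≤ (s i : ℝ) ∧ (s i : ℝ) ≤ 3 / 4) :
    smoothCollar (s 0, s 1) = 1 := by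
  simp only [smoothCollar]
  rw [Real.smoothTransition.one_of_one_le (by linarith [(hs 0).1]),
    Real.smoothTransition.one_of_one_le (by linarith [(hs 0).2]),
    Real.smoothTransition.one_of_one_le (by linarith [(hs 1).1]),
    Real.smoothTransition.one_of_one_le (by linarith [(hs 1).2])]
  norm_num

theorem exists_notMem_range_add_smul {ι : Type*} [Finite ι] (W : ι → Submodule ℝ V)
    (hW : ∀ i, Module.finrank ℝ (W i) + 3 < Module.finrank ℝ V) [Nontrivial V] {g : ℝ × ℝ → V}
    (hg : ContDiff ℝ 1 g) : ∃ a : V, ∀ i, ∀ x, ∀ r : ℝ, ∀ w ∈ W i, a ≠ w + r • g x := by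
  let Φ : ∀ i, (ℝ × ℝ) × ℝ × W i → V := fun i x => x.2.2 + x.2.1 • g x.1
  have hΦ : ∀ i, ContDiff ℝ 1 (Φ i) := fun i => by
    have h : ContDiff ℝ 1 fun x : (ℝ × ℝ) × ℝ × W i => ((x.2.2 : W i) : V) :=
      (W i).subtypeL.contDiff.comp (contDiff_snd.comp contDiff_snd)
    exact h.add ((contDiff_fst.comp contDiff_snd).smul (hg.comp contDiff_fst))
  have hV : 0 < Module.finrank ℝ V := Module.finrank_pos
  have hd : ∀ i, dimH (Set.range (Φ i)) ≤ (Module.finrank ℝ V - 1 : ℕ) := fun i => by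
    refine (hΦ i).dimH_range_le.trans ?_
    have h1 : Module.finrank ℝ ((ℝ × ℝ) × ℝ × W i) ≤ Module.finrank ℝ V - 1 := by
      simp only [Module.finrank_prod, Module.finrank_self]
      have := hW i
      omega
    exact_mod_cast h1
  have hdim : dimH (⋃ i, Set.range (Φ i)) < Module.finrank ℝ V := by
    rw [dimH_iUnion]
    refine (iSup_le hd).trans_lt ?_
    exact_mod_cast Nat.sub_lt hV one_pos
  obtain ⟨a, ha⟩ := (dense_compl_of_dimH_lt_finrank hdim).nonempty
  refine ⟨a, fun i x r w hw h => ha ?_⟩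
  exact Set.mem_iUnion.2 ⟨i, (x, r, ⟨w, hw⟩), h.symm⟩

theorem exists_freelyHomotopicIn_const_of_codim {ι : Type*} [Finite ι] (W : ι → Submodule ℝ V)
    (hW : ∀ i, Module.finrank ℝ (W i) + 3 < Module.finrank ℝ V) [Nontrivial V] {y : C(Sq, V)}
    (hb : ConstOnBoundary y) (hy : ∀ s i, y s ∉ W i) :
    ∃ c, FreelyHomotopicIn {v | ∀ i, v ∉ W i} y (ContinuousMap.const _ c) := by
  set S : Set V := {v | ∀ i, v ∉ W i} with hS
  have hSo : IsOpen S := by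
    have : S = ⋂ i, ((W i : Set V))ᶜ := by
      ext v
      simp [hS]
    rw [this]
    exact isOpen_iInter_of_finite fun i => (W i).closed_of_finiteDimensional.isOpen_compl
  have H₁ := freelyHomotopicIn_expandSq (S := S) hb hy
  set y' := y.comp ⟨expandSq 1, continuous_const.expandSq continuous_id⟩ with hy'
  have hy'e : ∀ s, (∃ i, (s i : ℝ) ≤ 1 / 4 ∨ 3 / 4 ≤ (s i : ℝ)) → y' s = y 0 := fun s hs =>
    hb _ (expandSq_one_mem_boundary hs) _ Sq.zero_mem_boundary
  obtain ⟨δ, hδ, hδS⟩ := (isCompact_range y'.continuous).exists_thickening_subset_open hSo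
    (by rintro _ ⟨s, rfl⟩; exact H₁.right.2 s)
  obtain ⟨F, hF, hFy⟩ := exists_contDiff_near (y' - ContinuousMap.const _ (y 0)) hδ
  let g : ℝ × ℝ → V := fun x => y 0 + smoothCollar x • F x
  have hg : ContDiff ℝ 1 g := contDiff_const.add (contDiff_smoothCollar.smul hF)
  have hgy : ∀ s : Sq, ‖g (s 0, s 1) - y' s‖ < δ := by
    intro s
    by_cases hs : ∀ i, 1 / 4 ≤ (s i : ℝ) ∧ (s i : ℝ) ≤ 3 / 4
    · have : g (s 0, s 1) - y' s =
          F (s 0, s 1) - (y' - ContinuousMap.const _ (y 0) : C(Sq, V)) s := by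
        simp only [g, smoothCollar_eq_one hs, one_smul, ContinuousMap.sub_apply,
          ContinuousMap.const_apply]
        abel
      rw [this]
      exact hFy s
    · have hs' : ∃ i, (s i : ℝ) ≤ 1 / 4 ∨ 3 / 4 ≤ (s i : ℝ) := by
        by_contra! h
        exact hs fun i => ⟨(h i).1.le, (h i).2.le⟩
      have h1 := hFy s
      simp only [ContinuousMap.sub_apply, ContinuousMap.const_apply, hy'e s hs', sub_self,
        sub_zero] at h1
      simp only [g, hy'e s hs', add_sub_cancel_left, norm_smul]
      have h2 := smoothCollar_mem_Icc (s 0, s 1)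
      rw [Real.norm_of_nonneg h2.1]
      refine lt_of_le_of_lt ?_ h1
      exact mul_le_of_le_one_left (norm_nonneg _) h2.2
  let G : C(Sq, V) := ⟨fun s => g (s 0, s 1), hg.continuous.comp (by fun_prop)⟩
  have hGb : ConstOnBoundary G := by
    have h : ∀ s ∈ Cube.boundary (Fin 2), G s = y 0 := fun s hs => by
      change y 0 + smoothCollar (s 0, s 1) • _ = y 0
      rw [smoothCollar_of_mem_boundary hs, zero_smul, add_zero]
    exact fun s hs s' hs' => (h s hs).trans (h s' hs').symm
  have H₂ : FreelyHomotopicIn S y' G := FreelyHomotopicIn.of_segment H₁.right.1 hGb fun s t => by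
    refine hδS (Metric.mem_thickening_iff.2 ⟨y' s, ⟨s, rfl⟩, ?_⟩)
    have : (1 - (t : ℝ)) • y' s + (t : ℝ) • G s - y' s = (t : ℝ) • (G s - y' s) := by
      module
    rw [dist_eq_norm, this, norm_smul, Real.norm_of_nonneg t.2.1]
    exact (mul_le_of_le_one_left (norm_nonneg _) t.2.2).trans_lt (hgy s)
  obtain ⟨a, ha⟩ := exists_notMem_range_add_smul W hW hg
  refine ⟨a, (H₁.trans H₂).trans (FreelyHomotopicIn.of_segment hGb (fun _ _ _ _ => rfl)
    fun s t i h => ?_)⟩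
  rcases eq_or_ne (t : ℝ) 0 with ht | ht
  · rw [ht] at h
    simp only [sub_zero, one_smul, zero_smul, add_zero] at h
    exact H₂.right.2 s i h
  · refine ha i (s 0, s 1) (-((t : ℝ)⁻¹ * (1 - t))) _ ((W i).smul_mem (t : ℝ)⁻¹ h) ?_
    change a = (t : ℝ)⁻¹ • ((1 - (t : ℝ)) • g (s 0, s 1) + (t : ℝ) • a) + _
    rw [smul_add, smul_smul, smul_smul, inv_mul_cancel₀ ht]
    module

end Codimension

/-! ### The complement of finitely many collinear points -/

section Collinear

open ComplexConjugate Complex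

/-- The factorisation coordinates: tuples of complex numbers with at most one zero entry. -/
def multiCone (k : ℕ) : Set (Fin (k + 1) → ℂ) := {y | ∀ i j, i ≠ j → y i = 0 → y j ≠ 0}

theorem multiCone_null (k : ℕ) {y : C(Sq, Fin (k + 1) → ℂ)} (hb : ConstOnBoundary y)
    (hy : ∀ s, y s ∈ multiCone k) :
    ∃ c, FreelyHomotopicIn (multiCone k) y (ContinuousMap.const _ c) := by
  let L : {p : Fin (k + 1) × Fin (k + 1) // p.1 ≠ p.2} → (Fin (k + 1) → ℂ) →ₗ[ℝ] ℂ × ℂ :=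
    fun p => (LinearMap.proj p.1.1).prod (LinearMap.proj p.1.2)
  have hL : ∀ p, Function.Surjective (L p) := by
    rintro ⟨⟨i, j⟩, hij⟩ ⟨a, b⟩
    refine ⟨Function.update (Function.update 0 i a) j b, ?_⟩
    have hij' : i ≠ j := hij
    simp [L, hij']
  have hmem : ∀ (v : Fin (k + 1) → ℂ) p, v ∈ LinearMap.ker (L p) ↔ v p.1.1 = 0 ∧ v p.1.2 = 0 := by
    intro v p
    simp [L]
  have hset : multiCone k = {v | ∀ p, v ∉ LinearMap.ker (L p)} := by
    ext v
    simp only [multiCone, Set.mem_ofPred_eq, hmem, Subtype.forall, Prod.forall, not_and]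
  rw [hset] at hy ⊢
  refine exists_freelyHomotopicIn_const_of_codim (fun p => LinearMap.ker (L p)) (fun p => ?_) hb hy
  have h := (L p).finrank_range_add_finrank_ker
  rw [LinearMap.range_eq_top.2 (hL p), finrank_top, Module.finrank_prod,
    Complex.finrank_real_complex] at h
  omega

/-- The product of the entries, together with a weighted average of the half-integers that tends
to `i + 1 / 2` when the `i`-th entry tends to `0`. -/
def multiConeProj (k : ℕ) (y : Fin (k + 1) → ℂ) : ℂ × ℝ :=
  (∏ i, y i, (∑ i : Fin (k + 1), ((i : ℕ) + 1 / 2 : ℝ) * ∏ j ∈ Finset.univ.erase i, ‖y j‖) /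
    ∑ i, ∏ j ∈ Finset.univ.erase i, ‖y j‖)

theorem multiCone_weight_pos {k : ℕ} {y : Fin (k + 1) → ℂ} (hy : y ∈ multiCone k) :
    0 < ∑ i, ∏ j ∈ Finset.univ.erase i, ‖y j‖ := by
  obtain ⟨i, hi⟩ : ∃ i, ∀ j, j ≠ i → y j ≠ 0 := by
    by_cases h : ∃ i, y i = 0
    · obtain ⟨i, hi⟩ := h
      exact ⟨i, fun j hj => hy i j hj.symm hi⟩
    · push Not at h
      exact ⟨0, fun j _ => h j⟩
  refine Finset.sum_pos' (fun i _ => by positivity) ⟨i, Finset.mem_univ i, ?_⟩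
  exact Finset.prod_pos fun j hj => norm_pos_iff.2 (hi j (Finset.ne_of_mem_erase hj))

theorem continuousOn_multiConeProj (k : ℕ) : ContinuousOn (multiConeProj k) (multiCone k) := by
  unfold multiConeProj
  refine ContinuousOn.prodMk (by fun_prop) (ContinuousOn.div (by fun_prop) (by fun_prop) ?_)
  exact fun y hy => (multiCone_weight_pos hy).ne'

theorem multiConeProj_snd {k : ℕ} {y : Fin (k + 1) → ℂ} (hy : y ∈ multiCone k) {i : Fin (k + 1)}
    (hi : y i = 0) : (multiConeProj k y).2 = (i : ℕ) + 1 / 2 := by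
  have h : ∀ l, l ≠ i → ∏ j ∈ Finset.univ.erase l, ‖y j‖ = 0 := fun l hl =>
    Finset.prod_eq_zero (Finset.mem_erase.2 ⟨hl.symm, Finset.mem_univ i⟩) (by simp [hi])
  have hpos := multiCone_weight_pos hy
  unfold multiConeProj
  rw [Finset.sum_eq_single i (fun l _ hl => h l hl) (by simp)] at hpos ⊢
  rw [Finset.sum_eq_single i (fun l _ hl => by rw [h l hl, mul_zero]) (by simp)]
  simp only
  field_simp

/-- The complement of the points `(0, 1), …, (0, k)`. -/
def collinearCompl (k : ℕ) : Set (ℂ × ℝ) := {v | ∀ j ∈ Finset.Icc 1 k, v ≠ (0, (j : ℝ))}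

theorem mapsTo_multiConeProj (k : ℕ) :
    Set.MapsTo (multiConeProj k) (multiCone k) (collinearCompl k) := by
  intro y hy j hj h
  have h1 : ∏ i, y i = 0 := congrArg Prod.fst h
  obtain ⟨i, -, hi⟩ := Finset.prod_eq_zero_iff.1 h1
  have h2 : (multiConeProj k y).2 = j := congrArg Prod.snd h
  rw [multiConeProj_snd hy hi] at h2
  have h3 : ((2 * i + 1 : ℕ) : ℝ) = ((2 * j : ℕ) : ℝ) := by push_cast; linarith
  have h4 := Nat.cast_injective h3
  omega

/-- The quotient `z' / z = w / w'`, where `z * w = z' * w'`. -/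
def ratio (z w z' w' : ℂ) : ℂ := (z' * conj z + w * conj w') / ((normSq z + normSq w' : ℝ) : ℂ)

theorem ratio_mul_left {z w z' w' : ℂ} (h : z * w = z' * w') (h0 : 0 < normSq z + normSq w') :
    ratio z w z' w' * z = z' := by
  have h0' : ((normSq z + normSq w' : ℝ) : ℂ) ≠ 0 := by exact_mod_cast h0.ne'
  rw [ratio, div_mul_eq_mul_div, div_eq_iff h0']
  push_cast
  rw [← mul_conj, ← mul_conj]
  linear_combination (conj w') * h

theorem ratio_mul_right {z w z' w' : ℂ} (h : z * w = z' * w') (h0 : 0 < normSq z + normSq w') :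
    ratio z w z' w' * w' = w := by
  have h0' : ((normSq z + normSq w' : ℝ) : ℂ) ≠ 0 := by exact_mod_cast h0.ne'
  rw [ratio, div_mul_eq_mul_div, div_eq_iff h0']
  push_cast
  rw [← mul_conj, ← mul_conj]
  linear_combination -(conj z) * h

/-- A map that has closed Hopf lifts relative to all the points `(0, 1), …, (0, k)` is
null-homotopic in their complement. -/
theorem exists_freelyHomotopicIn_const_collinear (k : ℕ) {f : C(Sq, ℂ × ℝ)}
    (hb : ConstOnBoundary f) (hf : ∀ s, f s ∈ collinearCompl k)
    (hd : ∀ j ∈ Finset.Icc 1 k, HopfDeg (f - ContinuousMap.const _ (0, (j : ℝ))) 0) :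
    ∃ c, FreelyHomotopicIn (collinearCompl k) f (ContinuousMap.const _ c) := by
  have hq : ∀ j, ∃ q : C(Sq, ℂ × ℂ), ConstOnBoundary q ∧ (∀ s, (q s).1 * (q s).2 = (f s).1) ∧
      (j = 0 → ∀ s, (q s).1 = 1) ∧ (j = k + 1 → ∀ s, (q s).2 = 1) ∧
      (j ∈ Finset.Icc 1 k → ∀ s, hopf (q s) = f s - (0, (j : ℝ))) := by
    intro j
    by_cases hj : j ∈ Finset.Icc 1 k
    · obtain ⟨q, hqf, hqb⟩ := hopfDeg_zero_iff.1 (hd j hj)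
      rw [Finset.mem_Icc] at hj
      refine ⟨q, hqb, fun s => ?_, fun h => by omega, fun h => by omega, fun _ s => hqf s⟩
      have := congrArg Prod.fst (hqf s)
      simpa [hopf] using this
    · by_cases hj0 : j = 0
      · refine ⟨⟨fun s => (1, (f s).1), by fun_prop⟩, fun s hs s' hs' => ?_, fun s => by simp,
          fun _ s => rfl, fun h => by omega, fun h => absurd h hj⟩
        simp [hb s hs s' hs']
      · refine ⟨⟨fun s => ((f s).1, 1), by fun_prop⟩, fun s hs s' hs' => ?_, fun s => by simp,
          fun h => absurd h hj0, fun _ s => rfl, fun h => absurd h hj⟩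
        simp [hb s hs s' hs']
  choose q hqb hqu hq0 hqk hqf using hq
  have hpos : ∀ j ∈ Finset.Icc 1 k, ∀ s, 0 < normSq (q j s).1 + normSq (q j s).2 := by
    intro j hj s
    refine normSq_add_normSq_pos ?_
    rw [hqf j hj s, sub_ne_zero]
    exact hf s j hj
  have hsnd : ∀ j ∈ Finset.Icc 1 k, ∀ s,
      normSq (q j s).1 - normSq (q j s).2 = (f s).2 - j := fun j hj s =>
    congrArg Prod.snd (hqf j hj s)
  have hlt : ∀ j ∈ Finset.Icc 1 k, ∀ s, (q j s).1 = 0 → (f s).2 < j := by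
    intro j hj s h
    have h1 := hpos j hj s
    have h2 := hsnd j hj s
    rw [h, map_zero] at h1 h2
    linarith
  have hgt : ∀ j ∈ Finset.Icc 1 k, ∀ s, (q j s).2 = 0 → j < (f s).2 := by
    intro j hj s h
    have h1 := hpos j hj s
    have h2 := hsnd j hj s
    rw [h, map_zero] at h1 h2
    linarith
  have hden : ∀ i ≤ k, ∀ s, 0 < normSq (q i s).1 + normSq (q (i + 1) s).2 := by
    intro i hi s
    have h1 := normSq_nonneg (q i s).1
    have h2 := normSq_nonneg (q (i + 1) s).2
    by_contra! h
    have h3 := normSq_eq_zero.1 (by linarith : normSq (q i s).1 = 0)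
    have h4 := normSq_eq_zero.1 (by linarith : normSq (q (i + 1) s).2 = 0)
    have hi0 : i ≠ 0 := fun h => by simp [hq0 i h] at h3
    have hik : i ≠ k := fun h => by simp [hqk (i + 1) (by omega)] at h4
    have h5 := hlt i (Finset.mem_Icc.2 (by omega)) s h3
    have h6 := hgt (i + 1) (Finset.mem_Icc.2 (by omega)) s h4
    push_cast at h6
    linarith
  let r : ℕ → Sq → ℂ := fun i s => ratio (q i s).1 (q i s).2 (q (i + 1) s).1 (q (i + 1) s).2
  have hrz : ∀ i ≤ k, ∀ s, r i s * (q i s).1 = (q (i + 1) s).1 := fun i hi s =>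
    ratio_mul_left (by rw [hqu, hqu]) (hden i hi s)
  have hrw : ∀ i ≤ k, ∀ s, r i s * (q (i + 1) s).2 = (q i s).2 := fun i hi s =>
    ratio_mul_right (by rw [hqu, hqu]) (hden i hi s)
  have hrc : ∀ i ≤ k, Continuous (r i) := by
    intro i hi
    have hne : ∀ s, ((normSq (q i s).1 + normSq (q (i + 1) s).2 : ℝ) : ℂ) ≠ 0 := fun s => by
      exact_mod_cast (hden i hi s).ne'
    have hn : Continuous normSq := continuous_normSq
    refine Continuous.div (by fun_prop) (continuous_ofReal.comp (Continuous.add ?_ ?_)) hne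
    · exact hn.comp (by fun_prop)
    · exact hn.comp (by fun_prop)
  have hzp : ∀ j ≤ k + 1, ∀ s, (q j s).1 = ∏ i ∈ Finset.range j, r i s := by
    intro j hj s
    induction j with
    | zero => simp [hq0 0 rfl]
    | succ j ih => rw [Finset.prod_range_succ, ← ih (by omega), mul_comm, hrz j (by omega)]
  have hu : ∀ s, (f s).1 = ∏ i ∈ Finset.range (k + 1), r i s := fun s => by
    rw [← hzp (k + 1) le_rfl, ← hqu (k + 1) s, hqk (k + 1) rfl, mul_one]
  have hr0 : ∀ i ≤ k, ∀ s, r i s = 0 → ∀ j ∈ Finset.Icc 1 k,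
      (j ≤ i → (j : ℝ) < (f s).2) ∧ (i < j → (f s).2 < j) := by
    intro i hi s hri j hj
    constructor
    · intro hji
      have hw : (q i s).2 = 0 := by rw [← hrw i hi, hri, zero_mul]
      have h1 : i ∈ Finset.Icc 1 k := Finset.mem_Icc.2 (by rw [Finset.mem_Icc] at hj; omega)
      have h2 := hgt i h1 s hw
      have h3 : (j : ℝ) ≤ i := by exact_mod_cast hji
      linarith
    · intro hij
      refine hlt j hj s ?_
      rw [hzp j (by rw [Finset.mem_Icc] at hj; omega)]
      exact Finset.prod_eq_zero (Finset.mem_range.2 hij) hri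
  let y : C(Sq, Fin (k + 1) → ℂ) := ⟨fun s i => r i s,
    continuous_pi fun i => hrc i (Nat.lt_succ_iff.1 i.2)⟩
  have hyb : ConstOnBoundary y := by
    intro s hs s' hs'
    change (fun i : Fin (k + 1) => r i s) = fun i : Fin (k + 1) => r i s'
    funext i
    simp only [r, hqb _ s hs s' hs']
  have hym : ∀ s, y s ∈ multiCone k := by
    intro s i j hij hi hj
    have key : ∀ i j : Fin (k + 1), i < j → y s i = 0 → y s j = 0 → False := by
      intro i j hij hi hj
      have hm : (j : ℕ) ∈ Finset.Icc 1 k := Finset.mem_Icc.2 (by omega)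
      have h1 := (hr0 i (by omega) s hi j hm).2 hij
      have h2 := (hr0 j (by omega) s hj j hm).1 le_rfl
      linarith
    rcases lt_or_gt_of_ne hij with h | h
    · exact key i j h hi hj
    · exact key j i h hj hi
  obtain ⟨c, hc⟩ := multiCone_null k hyb hym
  let g : C(Sq, ℂ × ℝ) := ⟨fun s => multiConeProj k (y s),
    (continuousOn_multiConeProj k).comp_continuous y.continuous hym⟩
  have H : FreelyHomotopicIn (collinearCompl k) g (ContinuousMap.const _ (multiConeProj k c)) :=
    hc.map (continuousOn_multiConeProj k) (mapsTo_multiConeProj k) (fun _ => rfl) fun _ => rfl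
  refine ⟨_, FreelyHomotopicIn.trans (g := g) (FreelyHomotopicIn.of_segment hb H.left.1 ?_) H⟩
  intro s t j hj h
  have hg1 : (g s).1 = (f s).1 := by
    rw [hu, Finset.prod_range]
    rfl
  have h1 := congrArg Prod.fst h
  have h2 := congrArg Prod.snd h
  simp only [Prod.fst_add, Prod.smul_fst, Prod.snd_add, Prod.smul_snd, hg1, ← add_smul,
    sub_add_cancel, one_smul, smul_eq_mul] at h1 h2
  rw [hu, Finset.prod_range] at h1
  obtain ⟨i, -, hi⟩ := Finset.prod_eq_zero_iff.1 h1
  have hg2 : (g s).2 = (i : ℕ) + 1 / 2 := multiConeProj_snd (hym s) hi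
  have h3 := hr0 i (by omega) s hi j hj
  rw [hg2] at h2
  have ht0 := t.2.1
  have ht1 := t.2.2
  have hcomb : ∀ a b : ℝ, 0 < a → 0 < b → 0 < (1 - (t : ℝ)) * a + t * b := fun a b ha hb => by
    rcases ht0.eq_or_lt with h0 | h0
    · rw [← h0]
      simpa using ha
    · exact add_pos_of_nonneg_of_pos (mul_nonneg (by linarith) ha.le) (mul_pos h0 hb)
  rcases le_or_gt j (i : ℕ) with hji | hji
  · have h5 : (j : ℝ) ≤ (i : ℕ) := by exact_mod_cast hji
    linarith [hcomb ((f s).2 - j) ((i : ℕ) + 1 / 2 - j) (by linarith [h3.1 hji]) (by linarith)]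
  · have h5 : ((i : ℕ) : ℝ) + 1 ≤ j := by exact_mod_cast hji
    linarith [hcomb (j - (f s).2) (j - ((i : ℕ) + 1 / 2)) (by linarith [h3.2 hji]) (by linarith)]

end Collinear

/-! ### Homotopy lifting for the map forgetting the last point of a configuration -/

section FadellNeuwirth

variable {V : Type*} [NormedAddCommGroup V] {n : ℕ}

/-- The configurations of `n` distinct points. -/
def injConf (n : ℕ) (V : Type*) : Set (Fin n → V) := {x | Function.Injective x}

theorem injConf_eq_iInter (n : ℕ) (V : Type*) :
    injConf n V = ⋂ p : {p : Fin n × Fin n // p.1 ≠ p.2}, {x | x p.1.1 = x p.1.2}ᶜ := by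
  ext x
  simp only [injConf, Function.Injective, Set.mem_iInter, Subtype.forall, Prod.forall]
  exact ⟨fun h i j hij hx => hij (h hx), fun h i j hx => by_contra fun hij => h i j hij hx⟩

theorem isOpen_injConf (n : ℕ) (V : Type*) [TopologicalSpace V] [T2Space V] :
    IsOpen (injConf n V) := by
  rw [injConf_eq_iInter]
  refine isOpen_iInter_of_finite fun p => IsClosed.isOpen_compl (self := ?_)
  exact isClosed_eq (continuous_apply _) (continuous_apply _)

/-- An upper bound for the inverses of the mutual distances. -/
def invSep (b : Fin n → V) : ℝ := 1 + ∑ i, ∑ j ∈ Finset.univ.erase i, ‖b i - b j‖⁻¹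

theorem continuousOn_invSep : ContinuousOn (invSep (V := V) (n := n)) (injConf n V) := by
  unfold invSep
  refine continuousOn_const.add (continuousOn_finsetSum _ fun i _ => continuousOn_finsetSum _
    fun j hj => ContinuousOn.inv₀ (by fun_prop) fun b hb => ?_)
  exact norm_ne_zero_iff.2 (sub_ne_zero.2 fun h => Finset.ne_of_mem_erase hj (hb h).symm)

theorem invSep_pos (b : Fin n → V) : 0 < invSep b := by
  unfold invSep
  positivity

theorem one_le_invSep_mul {b : Fin n → V} (hb : b ∈ injConf n V) {i j : Fin n} (hij : j ≠ i) :
    1 ≤ invSep b * ‖b j - b i‖ := by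
  have h0 : 0 < ‖b j - b i‖ := norm_pos_iff.2 (sub_ne_zero.2 fun h => hij (hb h))
  rw [← div_le_iff₀ h0, one_div]
  have h1 : ‖b j - b i‖⁻¹ ≤ ∑ l ∈ Finset.univ.erase j, ‖b j - b l‖⁻¹ :=
    Finset.single_le_sum (f := fun l => ‖b j - b l‖⁻¹) (fun l _ => by positivity)
      (Finset.mem_erase.2 ⟨hij.symm, Finset.mem_univ i⟩)
  have h2 : ∑ l ∈ Finset.univ.erase j, ‖b j - b l‖⁻¹ ≤
      ∑ i, ∑ l ∈ Finset.univ.erase i, ‖b i - b l‖⁻¹ :=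
    Finset.single_le_sum (f := fun i => ∑ l ∈ Finset.univ.erase i, ‖b i - b l‖⁻¹)
      (fun l _ => by positivity) (Finset.mem_univ j)
  unfold invSep
  linarith

/-- A bump function centred at the `i`-th point of the configuration. -/
def confBump (b : Fin n → V) (i : Fin n) (z : V) : ℝ := max 0 (1 - invSep b * ‖z - b i‖)

theorem abs_confBump_sub_le (b : Fin n → V) (i : Fin n) (z z' : V) :
    |confBump b i z - confBump b i z'| ≤ invSep b * ‖z - z'‖ := by
  refine (abs_max_sub_max_le_max _ _ _ _).trans ?_
  have h : (1 - invSep b * ‖z - b i‖) - (1 - invSep b * ‖z' - b i‖) =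
      invSep b * (‖z' - b i‖ - ‖z - b i‖) := by ring
  rw [sub_self, abs_zero, h, abs_mul, abs_of_pos (invSep_pos b)]
  refine max_le (mul_nonneg (invSep_pos b).le (norm_nonneg _))
    (mul_le_mul_of_nonneg_left ((abs_norm_sub_norm_le _ _).trans ?_) (invSep_pos b).le)
  rw [sub_sub_sub_cancel_right, norm_sub_rev]

theorem confBump_self {b : Fin n → V} (hb : b ∈ injConf n V) (i j : Fin n) :
    confBump b i (b j) = if i = j then 1 else 0 := by
  unfold confBump
  split_ifs with h
  · simp [h]
  · exact max_eq_left (by linarith [one_le_invSep_mul hb (Ne.symm h)])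

variable [NormedSpace ℝ V]

/-- Move the point `z` along with a small change `b'` of the configuration `b`. -/
def confMove (b b' : Fin n → V) (z : V) : V := z + ∑ i, confBump b i z • (b' i - b i)

theorem confMove_notMem_range {b b' : Fin n → V} (hb : b ∈ injConf n V)
    (h : invSep b * ∑ i, ‖b' i - b i‖ < 1) {z : V} (hz : z ∉ Set.range b) :
    confMove b b' z ∉ Set.range b' := by
  rintro ⟨j, hj⟩
  have h1 : b' j = b j + ∑ i, confBump b i (b j) • (b' i - b i) := by
    simp [confBump_self hb]
  rw [h1, confMove] at hj
  have h2 : z - b j = ∑ i, (confBump b i (b j) - confBump b i z) • (b' i - b i) := by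
    simp only [sub_smul, Finset.sum_sub_distrib]
    rw [sub_eq_sub_iff_add_eq_add, ← hj, add_comm]
  have h0 : 0 < ‖z - b j‖ := norm_pos_iff.2 (sub_ne_zero.2 fun h => hz ⟨j, h.symm⟩)
  have h3 : ‖z - b j‖ ≤ ∑ i, invSep b * ‖z - b j‖ * ‖b' i - b i‖ := by
    conv_lhs => rw [h2]
    refine (norm_sum_le _ _).trans (Finset.sum_le_sum fun i _ => ?_)
    rw [norm_smul, Real.norm_eq_abs, norm_sub_rev z]
    exact mul_le_mul_of_nonneg_right (abs_confBump_sub_le _ _ _ _) (norm_nonneg _)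
  rw [← Finset.mul_sum] at h3
  nlinarith

theorem confMove_self (b : Fin n → V) (z : V) : confMove b b z = z := by simp [confMove]

/-- Homotopy lifting for the map forgetting a point of a configuration. -/
theorem exists_config_lift {K : Type*} [TopologicalSpace K] [CompactSpace K]
    (F : C(unitInterval × K, Fin n → V)) (hF : ∀ x, F x ∈ injConf n V) (z₀ : C(K, V))
    (hz₀ : ∀ k, z₀ k ∉ Set.range (F (0, k))) :
    ∃ G : C(unitInterval × K, V), (∀ x, G x ∉ Set.range (F x)) ∧ (∀ k, G (0, k) = z₀ k) ∧
      ∀ k k', (∀ t, F (t, k) = F (t, k')) → z₀ k = z₀ k' → ∀ t, G (t, k) = G (t, k') := by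
  let U : Set ((Fin n → V) × (Fin n → V)) :=
    {x | invSep x.1 * ∑ i, ‖x.2 i - x.1 i‖ < 1} ∩ (injConf n V ×ˢ injConf n V)
  let S : Set ((Fin n → V) × V) := {e | e.1 ∈ injConf n V ∧ e.2 ∉ Set.range e.1}
  have hU : IsOpen U := by
    rw [show U = _ from Set.inter_comm _ _]
    refine ContinuousOn.isOpen_inter_preimage
      (f := fun x : (Fin n → V) × (Fin n → V) => invSep x.1 * ∑ i, ‖x.2 i - x.1 i‖)
      (t := Set.Iio 1) ?_
      ((isOpen_injConf n V).prod (isOpen_injConf n V)) isOpen_Iio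
    refine ContinuousOn.mul ?_ (Continuous.continuousOn (by fun_prop))
    exact continuousOn_invSep.comp continuousOn_fst fun x hx => hx.1
  have hT : ContinuousOn (fun x : (Fin n → V) × ((Fin n → V) × V) =>
      (x.1, confMove x.2.1 x.1 x.2.2)) {x | x.2 ∈ S ∧ (x.2.1, x.1) ∈ U} := by
    have h1 : ContinuousOn (fun x : (Fin n → V) × ((Fin n → V) × V) => invSep x.2.1)
        {x | x.2 ∈ S ∧ (x.2.1, x.1) ∈ U} :=
      continuousOn_invSep.comp (by fun_prop) fun x hx => hx.1.1
    unfold confMove confBump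
    fun_prop
  obtain ⟨G, hG, hG0, -, hGg⟩ := exists_transport_lift (K := K) (S := S) Prod.fst hU
    (fun b e => (b, confMove e.1 b e.2)) hT
    (fun b e he h => ⟨⟨h.2.2, confMove_notMem_range he.1 h.1 he.2⟩, rfl⟩)
    (fun e _ => by simp [confMove_self]) F
    (fun x => ⟨by simp, hF x, hF x⟩)
    ⟨fun k => (F (0, k), z₀ k), by fun_prop⟩ (fun k => ⟨⟨hF _, hz₀ k⟩, rfl⟩)
  refine ⟨⟨fun x => (G x).2, by fun_prop⟩, fun x => ?_, fun k => ?_, fun k k' hk hz t => ?_⟩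
  · rw [← (hG x).2]
    exact (hG x).1.2
  · exact congrArg Prod.snd (hG0 k)
  · exact congrArg Prod.snd (hGg id (fun _ _ _ _ => rfl) k k' hk (by simp [hk 0, hz]) t)

end FadellNeuwirth

/-! ### Maps from the square to configuration spaces -/

section Configurations

theorem FreelyHomotopicIn.const_of_joinedIn {X : Type*} [TopologicalSpace X] {S : Set X} {c d : X}
    (h : JoinedIn S c d) :
    FreelyHomotopicIn S (ContinuousMap.const Sq c) (ContinuousMap.const Sq d) := by
  obtain ⟨γ, hγ⟩ := h
  exact FreelyHomotopicIn.iff_exists.2 ⟨⟨fun x => γ x.1, by fun_prop⟩, fun s => γ.source,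
    fun s => γ.target, fun t s _ s' _ => rfl, fun x => hγ x.1⟩

theorem joinedIn_injConf {V : Type*} [NormedAddCommGroup V] [NormedSpace ℝ V]
    (hV : 1 < Module.finrank ℝ V) {n : ℕ} {c d : Fin n → V} (hc : c ∈ injConf n V)
    (hd : d ∈ injConf n V) : JoinedIn (injConf n V) c d := by
  obtain ⟨w, hw⟩ : ∃ w : V, ∀ x ∈ ({c, d} : Set (Fin n → V)), ∀ i j, ∀ r : ℝ,
      r • (x i - x j) ≠ w := by
    by_contra! h
    have hcov : ⋃ p : ({c, d} : Set (Fin n → V)) × Fin n × Fin n,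
        ((ℝ ∙ (p.1.1 p.2.1 - p.1.1 p.2.2) : Submodule ℝ V) : Set V) = Set.univ := by
      refine Set.eq_univ_of_forall fun w => ?_
      obtain ⟨x, hx, i, j, r, hr⟩ := h w
      exact Set.mem_iUnion.2 ⟨(⟨x, hx⟩, i, j), Submodule.mem_span_singleton.2 ⟨r, hr⟩⟩
    obtain ⟨p, hp⟩ := Subspace.exists_eq_top_of_iUnion_eq_univ hcov
    have h1 := finrank_span_le_card (R := ℝ) {p.1.1 p.2.1 - p.1.1 p.2.2}
    rw [hp, finrank_top, Set.toFinset_singleton, Finset.card_singleton] at h1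
    omega
  have key : ∀ x ∈ ({c, d} : Set (Fin n → V)), x ∈ injConf n V →
      JoinedIn (injConf n V) x fun i => ((i : ℕ) : ℝ) • w := by
    intro x hx hxi
    refine JoinedIn.of_segment_subset ?_
    rw [segment_eq_image]
    rintro _ ⟨t, ht, rfl⟩ i j hij
    by_contra hne
    simp only [Pi.add_apply, Pi.smul_apply] at hij
    have h1 : (1 - t) • (x i - x j) = (t * ((j : ℕ) - (i : ℕ) : ℝ)) • w := by
      rw [smul_sub, mul_smul, sub_smul (j : ℝ), smul_sub, sub_eq_sub_iff_add_eq_add, hij, add_comm]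
    have h2 : ((j : ℕ) - (i : ℕ) : ℝ) ≠ 0 := sub_ne_zero.2 fun h =>
      hne (Fin.ext (Nat.cast_injective h)).symm
    rcases eq_or_ne t 0 with h0 | h0
    · rw [h0] at h1
      simp only [sub_zero, one_smul, zero_mul, zero_smul, sub_eq_zero] at h1
      exact hne (hxi h1)
    · refine hw x hx i j ((t * ((j : ℕ) - (i : ℕ) : ℝ))⁻¹ * (1 - t)) ?_
      rw [mul_smul, h1, smul_smul, inv_mul_cancel₀ (mul_ne_zero h0 h2), one_smul]
  exact (key c (by simp) hc).trans (key d (by simp) hd).symm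

/-- The difference of two of the points of a configuration. -/
def pairDiff {n : ℕ} (i j : Fin n) (f : C(Sq, Fin n → ℂ × ℝ)) : C(Sq, ℂ × ℝ) :=
  ⟨fun s => f s j - f s i, by fun_prop⟩

theorem FreelyHomotopicIn.pairDiff {n : ℕ} {f g : C(Sq, Fin n → ℂ × ℝ)}
    (H : FreelyHomotopicIn (injConf n (ℂ × ℝ)) f g) {i j : Fin n} (hij : i ≠ j) :
    FreelyHomotopicIn {0}ᶜ (_root_.pairDiff i j f) (_root_.pairDiff i j g) :=
  H.map (S' := {0}ᶜ) (φ := fun x => x j - x i) (Continuous.continuousOn (by fun_prop))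
    (fun x (hx : Function.Injective x) h => hij (hx (sub_eq_zero.1 h)).symm) (fun _ => rfl)
    fun _ => rfl

/-- The configuration with a point appended. -/
def confSnoc {V : Type*} {n : ℕ} (x : Fin n → V) (y : V) : Fin (n + 1) → V :=
  Fin.snoc (α := fun _ => V) x y

@[simp] theorem confSnoc_last {V : Type*} {n : ℕ} (x : Fin n → V) (y : V) :
    confSnoc x y (Fin.last n) = y := Fin.snoc_last (α := fun _ => V) y x

@[simp] theorem confSnoc_castSucc {V : Type*} {n : ℕ} (x : Fin n → V) (y : V) (i : Fin n) :
    confSnoc x y i.castSucc = x i := Fin.snoc_castSucc (α := fun _ => V) y x i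

theorem Continuous.confSnoc {Z V : Type*} [TopologicalSpace Z] [TopologicalSpace V] {n : ℕ}
    {x : Z → Fin n → V} {y : Z → V} (hx : Continuous x) (hy : Continuous y) :
    Continuous fun z => confSnoc (x z) (y z) :=
  Continuous.finSnoc (A := fun _ => V) hx hy

theorem confSnoc_mem_injConf {V : Type*} {n : ℕ} {x : Fin n → V} {y : V} (hx : x ∈ injConf n V)
    (hy : y ∉ Set.range x) : confSnoc x y ∈ injConf (n + 1) V :=
  Fin.snoc_injective_iff.2 ⟨hx, hy⟩

/-- A map to the configuration space all of whose degrees vanish is null-homotopic. -/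
theorem exists_freelyHomotopicIn_const_injConf (n : ℕ) {f : C(Sq, Fin n → ℂ × ℝ)}
    (hb : ConstOnBoundary f) (hf : ∀ s, f s ∈ injConf n (ℂ × ℝ))
    (hd : ∀ i j, i < j → HopfDeg (pairDiff i j f) 0) :
    ∃ c, FreelyHomotopicIn (injConf n (ℂ × ℝ)) f (ContinuousMap.const _ c) := by
  induction n with
  | zero =>
    refine ⟨f 0, ?_⟩
    rw [show ContinuousMap.const Sq (f 0) = f from ContinuousMap.ext fun _ => Subsingleton.elim _ _]
    exact FreelyHomotopicIn.refl hb hf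
  | succ n ih =>
    let f' : C(Sq, Fin n → ℂ × ℝ) := ⟨fun s => Fin.init (α := fun _ => ℂ × ℝ) (f s), by
      unfold Fin.init
      fun_prop⟩
    have hf' : ∀ s, f' s ∈ injConf n (ℂ × ℝ) := fun s =>
      (hf s).comp (Fin.castSucc_injective n)
    obtain ⟨c, hc⟩ := ih (f := f')
      (fun s hs s' hs' => congrArg (Fin.init (α := fun _ => ℂ × ℝ)) (hb s hs s' hs')) hf'
      fun i j hij => hd i.castSucc j.castSucc (by simpa using hij)
    let p : Fin n → ℂ × ℝ := fun i => (0, (i : ℕ) + 1)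
    have hp : p ∈ injConf n (ℂ × ℝ) := fun i j h => by
      have h1 : ((i : ℕ) : ℝ) + 1 = (j : ℕ) + 1 := congrArg Prod.snd h
      exact Fin.ext (Nat.cast_injective (add_right_cancel h1))
    have hrank : 1 < Module.finrank ℝ (ℂ × ℝ) := by
      simp [Module.finrank_prod, Complex.finrank_real_complex]
    have hc' := hc.trans (FreelyHomotopicIn.const_of_joinedIn
      (joinedIn_injConf hrank (hc.right.2 0) hp))
    obtain ⟨F, hF0, hF1, hFb, hFm⟩ := FreelyHomotopicIn.iff_exists.1 hc'
    obtain ⟨G, hG, hG0, hGb⟩ := exists_config_lift F hFm ⟨fun s => f s (Fin.last n), by fun_prop⟩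
      fun s => by
        rw [hF0]
        rintro ⟨i, hi⟩
        exact (Fin.castSucc_lt_last i).ne (hf s hi)
    let g : C(Sq, ℂ × ℝ) := ⟨fun s => G (1, s), by fun_prop⟩
    let pg : C(Sq, Fin (n + 1) → ℂ × ℝ) := ⟨fun s => confSnoc p (g s),
      continuous_const.confSnoc g.continuous⟩
    have H₁ : FreelyHomotopicIn (injConf (n + 1) (ℂ × ℝ)) f pg := by
      refine FreelyHomotopicIn.iff_exists.2 ⟨⟨fun x => confSnoc (F x) (G x),
        F.continuous.confSnoc G.continuous⟩, fun s => ?_, fun s => ?_, fun t s hs s' hs' => ?_,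
        fun x => confSnoc_mem_injConf (hFm x) (hG x)⟩
      · change confSnoc (F (0, s)) (G (0, s)) = f s
        rw [hF0, hG0]
        exact Fin.snoc_init_self (α := fun _ => ℂ × ℝ) (f s)
      · change confSnoc (F (1, s)) (G (1, s)) = confSnoc p (G (1, s))
        rw [hF1]
        rfl
      · change confSnoc (F (t, s)) (G (t, s)) =
          confSnoc (F (t, s')) (G (t, s'))
        have h1 : F (t, s) = F (t, s') := hFb t s hs s' hs'
        have h2 : G (t, s) = G (t, s') := hGb s s' (fun t => hFb t s hs s' hs')
          (by simp [hb s hs s' hs']) t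
        rw [h1, h2]
    have hgp : ∀ s, g s ∉ Set.range p := fun s h => hG (1, s) (by rwa [hF1])
    have hp' : ∀ j ∈ Finset.Icc 1 n, ∃ i : Fin n, p i = (0, (j : ℝ)) ∧ (i : ℕ) + 1 = j := by
      intro j hj
      rw [Finset.mem_Icc] at hj
      refine ⟨⟨j - 1, by omega⟩, ?_, by simp; omega⟩
      simp only [p]
      rw [← Nat.cast_add_one, Nat.sub_add_cancel hj.1]
    have hgm : ∀ s, g s ∈ collinearCompl n := fun s j hj h => by
      obtain ⟨i, hi, -⟩ := hp' j hj
      exact hgp s ⟨i, hi.trans h.symm⟩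
    obtain ⟨a, ha⟩ := exists_freelyHomotopicIn_const_collinear n (f := g)
      (fun s hs s' hs' => by
        have := congrArg (fun x => x (Fin.last n)) (H₁.right.1 s hs s' hs')
        simpa [pg] using this) hgm fun j hj => by
        obtain ⟨i, hi, -⟩ := hp' j hj
        have h1 := (hd i.castSucc (Fin.last n) (Fin.castSucc_lt_last i)).of_freelyHomotopicIn
          (H₁.pairDiff (Fin.castSucc_lt_last i).ne)
        convert h1 using 1
        ext s : 1
        simp [pairDiff, pg, hi]
    refine ⟨confSnoc p a, H₁.trans (ha.map (φ := fun y => confSnoc p y) ?_ ?_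
      (fun _ => rfl) fun _ => rfl)⟩
    · exact (continuous_const.confSnoc continuous_id).continuousOn
    · rintro y hy
      refine confSnoc_mem_injConf hp ?_
      rintro ⟨i, hi⟩
      refine hy ((i : ℕ) + 1) (Finset.mem_Icc.2 (by omega)) ?_
      rw [← hi]
      simp [p]

end Configurations

/-! ### The second homotopy group -/

/-- A homotopy invariant with values in `ℤ^ι` that is additive, detects null-homotopic loops, and
takes the standard basis vectors as values, computes the second homotopy group. -/
theorem nonempty_pi_two_mulEquiv {X : Type*} [TopologicalSpace X] {c : X} {ι : Type*} [Finite ι]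
    [DecidableEq ι] (deg : GenLoop (Fin 2) X c → ι → ℤ)
    (hhom : ∀ f g, GenLoop.Homotopic f g → deg f = deg g)
    (hadd : ∀ f g, deg (GenLoop.transAt 0 f g) = deg f + deg g)
    (hker : ∀ f, deg f = 0 → GenLoop.Homotopic f GenLoop.const)
    (hsurj : ∀ i, ∃ f, deg f = Pi.single i 1) :
    Nonempty (π_ 2 X c ≃* Multiplicative (ι → ℤ)) := by
  cases nonempty_fintype ι
  let D₀ : π_ 2 X c → Multiplicative (ι → ℤ) :=
    Quotient.lift (fun f => Multiplicative.ofAdd (deg f)) fun f g h => by rw [hhom f g h]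
  let D : π_ 2 X c →* Multiplicative (ι → ℤ) := MonoidHom.mk' D₀ fun a b => by
    induction a using Quotient.inductionOn with | _ f
    induction b using Quotient.inductionOn with | _ g
    have h := congrArg D₀ (HomotopyGroup.mul_spec (i := 0) (p := f) (q := g))
    refine h.trans ?_
    change Multiplicative.ofAdd (deg _) =
      Multiplicative.ofAdd (deg f) * Multiplicative.ofAdd (deg g)
    rw [hadd, add_comm, ofAdd_add]
  refine ⟨MulEquiv.ofBijective D ⟨(injective_iff_map_eq_one D).2 fun a ha => ?_, ?_⟩⟩
  · induction a using Quotient.inductionOn with | _ f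
    rw [HomotopyGroup.one_def]
    exact Quotient.sound (hker f ha)
  · rw [← MonoidHom.range_eq_top, Subgroup.eq_top_iff']
    intro x
    have hx : x = ∏ i, Multiplicative.ofAdd (Pi.single i (1 : ℤ) : ι → ℤ) ^ (x.toAdd i) := by
      apply Multiplicative.toAdd.injective
      ext j
      simp [toAdd_prod, Finset.sum_apply, Pi.single_apply]
    rw [hx]
    refine Subgroup.prod_mem _ fun i _ => Subgroup.zpow_mem _ ?_ _
    obtain ⟨f, hf⟩ := hsurj i
    refine ⟨(Quotient.mk _ f : HomotopyGroup (Fin 2) X c), ?_⟩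
    exact congrArg Multiplicative.ofAdd hf

theorem card_pairs (n : ℕ) :
    Fintype.card {p : Fin n × Fin n // p.1 < p.2} = n * (n - 1) / 2 := by
  let e : {p : Fin n × Fin n // p.1 < p.2} ≃ Σ j : Fin n, Fin j :=
    { toFun := fun p => ⟨p.1.2, ⟨p.1.1, p.2⟩⟩
      invFun := fun x => ⟨(⟨x.2, x.2.2.trans x.1.2⟩, x.1), x.2.2⟩
      left_inv := fun _ => rfl
      right_inv := fun _ => rfl }
  rw [Fintype.card_congr e, Fintype.card_sigma]
  simp only [Fintype.card_fin]
  rw [← Finset.sum_range_id, Finset.sum_range]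

theorem FreelyHomotopicIn.of_homeomorph {X Y : Type*} [TopologicalSpace X] [TopologicalSpace Y]
    {S : Set Y} (e : X ≃ₜ S) {f g : C(Sq, X)} {f' g' : C(Sq, Y)} (H : FreelyHomotopicIn S f' g')
    (hf : ∀ s, f' s = e (f s)) (hg : ∀ s, g' s = e (g s)) : FreelyHomotopicIn Set.univ f g := by
  obtain ⟨H, h0, h1, hb, hS⟩ := iff_exists.1 H
  refine iff_exists.2 ⟨⟨fun x => e.symm ⟨H x, hS x⟩, by fun_prop⟩, fun s => ?_, fun s => ?_,
    fun t s hs s' hs' => ?_, fun _ => trivial⟩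
  · exact e.symm_apply_eq.2 (Subtype.ext ((h0 s).trans (hf s)))
  · exact e.symm_apply_eq.2 (Subtype.ext ((h1 s).trans (hg s)))
  · exact congrArg e.symm (Subtype.ext (hb t s hs s' hs'))

/-- Configurations in Euclidean space as configurations in `ℂ × ℝ`. -/
def confHomeo (n : ℕ) : Conf n (Set.univ : Set R3) ≃ₜ injConf n (ℂ × ℝ) :=
  let φ : R3 ≃L[ℝ] ℂ × ℝ := ContinuousLinearEquiv.ofFinrankEq
    (by simp [Module.finrank_prod, Complex.finrank_real_complex])
  { toFun := fun x => ⟨fun i => φ (x.1 i), φ.injective.comp x.2.1⟩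
    invFun := fun x => ⟨fun i => φ.symm (x.1 i), φ.symm.injective.comp x.2, fun _ => trivial⟩
    left_inv := fun x => Subtype.ext (funext fun i => φ.symm_apply_apply _)
    right_inv := fun x => Subtype.ext (funext fun i => φ.apply_symm_apply _)
    continuous_toFun := Continuous.subtype_mk (continuous_pi fun i =>
      φ.continuous.comp ((continuous_apply i).comp continuous_subtype_val)) _
    continuous_invFun := Continuous.subtype_mk (continuous_pi fun i =>
      φ.symm.continuous.comp ((continuous_apply i).comp continuous_subtype_val)) _ }

theorem hopfDeg_zero_of_snd {f : C(Sq, ℂ × ℝ)} (hb : ConstOnBoundary f) (ε : ℝ) (hε : ε ≠ 0)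
    (hf : ∀ s, 0 < ε * (f s).2) : HopfDeg f 0 := by
  refine (hopfDeg_const (0, ε)).of_freelyHomotopicIn (FreelyHomotopicIn.symm
    (FreelyHomotopicIn.of_segment hb (fun _ _ _ _ => rfl) fun s t h => ?_))
  have h1 : (1 - (t : ℝ)) * (f s).2 + t * ε = 0 := congrArg Prod.snd h
  have h2 : (1 - (t : ℝ)) * (ε * (f s).2) + t * ε ^ 2 = 0 := by linear_combination ε * h1
  have h3 : 0 < ε ^ 2 := by positivity
  rcases t.2.1.eq_or_lt with h0 | h0
  · rw [← h0] at h2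
    linarith [hf s]
  · linarith [mul_pos h0 h3, mul_nonneg (sub_nonneg.2 t.2.2) (hf s).le]

/-- The `j`-th point circles once around the `i`-th point, and the other points stay far away. -/
theorem exists_pairDiff_single {n : ℕ} {i j : Fin n} (hij : i < j) :
    ∃ f : C(Sq, Fin n → ℂ × ℝ), ConstOnBoundary f ∧ (∀ s, f s ∈ injConf n (ℂ × ℝ)) ∧
      ∀ a b, a < b → HopfDeg (pairDiff a b f) (if a = i ∧ b = j then 1 else 0) := by
  obtain ⟨g, hgb, hg0, hg1, hgd⟩ := exists_hopfDeg_one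
  let x : Fin n → Sq → ℂ × ℝ := fun k s =>
    if k = i then 0 else if k = j then g s else (0, (k : ℕ) + 2)
  have hxc : ∀ k, Continuous (x k) := fun k => by
    unfold x
    split_ifs <;> fun_prop
  have hxi : ∀ s, x i s = 0 := fun s => if_pos rfl
  have hxj : ∀ s, x j s = g s := fun s => by simp [x, hij.ne']
  have hxk : ∀ k, k ≠ i → k ≠ j → ∀ s, x k s = (0, ((k : ℕ) : ℝ) + 2) := fun k hki hkj s => by
    simp [x, hki, hkj]
  have hx2 : ∀ k, k ≠ i → k ≠ j → ∀ s, (x k s).2 = ((k : ℕ) : ℝ) + 2 := fun k hki hkj s => by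
    rw [hxk k hki hkj]
  let f : C(Sq, Fin n → ℂ × ℝ) := ⟨fun s k => x k s, continuous_pi hxc⟩
  have hfb : ConstOnBoundary f := fun s hs s' hs' => by
    change (fun k => x k s) = fun k => x k s'
    simp only [x, hgb s hs s' hs']
  have hdb : ∀ a b, ConstOnBoundary (pairDiff a b f) := fun a b s hs s' hs' => by
    simp [pairDiff, hfb s hs s' hs']
  refine ⟨f, hfb, fun s => ?_, fun a b hab => ?_⟩
  · have key : ∀ a b, a < b → x a s ≠ x b s := by
      intro a b hab h
      have h2 := congrArg Prod.snd h
      have ha0 : (0 : ℝ) ≤ (a : ℕ) := Nat.cast_nonneg _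
      have hb0 : (0 : ℝ) ≤ (b : ℕ) := Nat.cast_nonneg _
      have hg1' := hg1 s
      have hab' : ((a : ℕ) : ℝ) < (b : ℕ) := by exact_mod_cast hab
      by_cases hai : a = i
      · subst hai
        by_cases hbj : b = j
        · subst hbj
          rw [hxi, hxj] at h
          exact hg0 s h.symm
        · rw [hxi, hx2 b hab.ne' hbj, Prod.snd_zero] at h2
          linarith
      by_cases haj : a = j
      · subst haj
        rw [hxj, hx2 b (hij.trans hab).ne' hab.ne'] at h2
        linarith
      rw [hx2 a hai haj] at h2
      by_cases hbi : b = i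
      · subst hbi
        rw [hxi, Prod.snd_zero] at h2
        linarith
      by_cases hbj : b = j
      · subst hbj
        rw [hxj] at h2
        linarith
      rw [hx2 b hbi hbj] at h2
      linarith
    intro a b h
    rcases lt_trichotomy a b with hab | hab | hab
    · exact absurd h (key a b hab)
    · exact hab
    · exact absurd h.symm (key b a hab)
  · have hconst : ∀ k, k ≠ j → ∀ s, x k s = x k 0 := fun k hk s => by simp [x, hk]
    by_cases hbj : b = j
    · subst hbj
      by_cases hai : a = i
      · subst hai
        rw [if_pos ⟨rfl, rfl⟩]
        convert hgd using 1
        ext s : 1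
        change x b s - x a s = g s
        rw [hxi, hxj, sub_zero]
      · rw [if_neg fun h => hai h.1]
        refine hopfDeg_zero_of_snd (hdb a b) (-1) (by norm_num) fun s => ?_
        change 0 < -1 * (x b s - x a s).2
        rw [Prod.snd_sub, hxj, hx2 a hai hab.ne]
        have ha0 : (0 : ℝ) ≤ (a : ℕ) := Nat.cast_nonneg _
        linarith [hg1 s]
    · rw [if_neg fun h => hbj h.2]
      by_cases haj : a = j
      · subst haj
        refine hopfDeg_zero_of_snd (hdb a b) 1 one_ne_zero fun s => ?_
        change 0 < 1 * (x b s - x a s).2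
        rw [Prod.snd_sub, hxj, hx2 b (hij.trans hab).ne' hab.ne']
        have hb0 : (0 : ℝ) ≤ (b : ℕ) := Nat.cast_nonneg _
        linarith [hg1 s]
      · convert hopfDeg_const (x b 0 - x a 0) using 1
        ext s : 1
        change x b s - x a s = x b 0 - x a 0
        rw [hconst a haj, hconst b hbj]

theorem nonempty_pi_two_of_homeomorph {X : Type*} [TopologicalSpace X] {n : ℕ}
    (e : X ≃ₜ injConf n (ℂ × ℝ)) (c : X) :
    Nonempty (π_ 2 X c ≃* Multiplicative (Fin (n * (n - 1) / 2) → ℤ)) := by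
  let ι := {p : Fin n × Fin n // p.1 < p.2}
  let amb : C(Sq, X) → C(Sq, Fin n → ℂ × ℝ) := fun f =>
    ⟨fun s => (e (f s)).1, by fun_prop⟩
  have hamb : ∀ f g, FreelyHomotopicIn Set.univ f g →
      FreelyHomotopicIn (injConf n (ℂ × ℝ)) (amb f) (amb g) := fun f g H =>
    H.map (continuous_subtype_val.comp e.continuous).continuousOn (fun x _ => (e x).2)
      (fun _ => rfl) fun _ => rfl
  have hne : ∀ f (p : ι) s, pairDiff p.1.1 p.1.2 (amb f) s ≠ 0 := fun f p s h =>
    p.2.ne' ((e (f s)).2 (sub_eq_zero.1 h))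
  have hbd : ∀ f : GenLoop (Fin 2) X c, ConstOnBoundary f.1 :=
    fun f s hs s' hs' => (f.2 s hs).trans (f.2 s' hs').symm
  have hdeg : ∀ f : GenLoop (Fin 2) X c, ∃ d : ι → ℤ,
      ∀ p : ι, HopfDeg (pairDiff p.1.1 p.1.2 (amb f)) (d p) := fun f => by
    have h : ∀ p : ι, ∃ d, HopfDeg (pairDiff p.1.1 p.1.2 (amb f)) d := fun p =>
      HopfDeg.exists (fun s hs s' hs' => by
        exact congrArg (fun x => (e x).1 p.1.2 - (e x).1 p.1.1) (hbd f s hs s' hs')) (hne f p)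
    choose d hd using h
    exact ⟨d, hd⟩
  choose deg hdeg using hdeg
  have huniq : ∀ (f : GenLoop (Fin 2) X c) (d : ι → ℤ),
      (∀ p : ι, HopfDeg (pairDiff p.1.1 p.1.2 (amb f)) (d p)) →
      deg f = d := fun f d hd => funext fun p => (hdeg f p).unique (hne f p) (hd p)
  have h := nonempty_pi_two_mulEquiv deg (fun f g H => ?_) (fun f g => ?_) (fun f hf => ?_)
    fun p => ?_
  · exact h.map fun φ => φ.trans (LinearEquiv.funCongrLeft ℤ ℤ
      (Fintype.equivFinOfCardEq (card_pairs n)).symm).toAddEquiv.toMultiplicative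
  · refine huniq f _ fun p => ?_
    refine (hdeg g p).of_freelyHomotopicIn ((hamb _ _ ?_).symm.pairDiff p.2.ne)
    obtain ⟨H⟩ := H
    refine FreelyHomotopicIn.iff_exists.2 ⟨H.toContinuousMap, H.apply_zero, H.apply_one,
      fun t s hs s' hs' => ?_, fun _ => trivial⟩
    change H (t, s) = H (t, s')
    rw [H.eq_fst t hs, H.eq_fst t hs']
    exact hbd f s hs s' hs'
  · refine huniq _ _ fun p => ?_
    refine HopfDeg.glue ?_ (fun s => ?_) (hdeg f p) (hdeg g p)
    · exact congrArg (fun x => (e x).1 p.1.2 - (e x).1 p.1.1)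
        ((f.2 0 Sq.zero_mem_boundary).trans (g.2 0 Sq.zero_mem_boundary).symm)
    · change (e (GenLoop.transAt 0 f g s)).1 p.1.2 - (e (GenLoop.transAt 0 f g s)).1 p.1.1 = _
      have : GenLoop.transAt 0 f g s = if (s 0 : ℝ) ≤ 1 / 2
          then f (Function.update s 0 (Set.projIcc 0 1 zero_le_one (2 * (s 0 : ℝ))))
          else g (Function.update s 0 (Set.projIcc 0 1 zero_le_one (2 * (s 0 : ℝ) - 1))) := rfl
      rw [this]
      split_ifs <;> rfl
  · obtain ⟨a, ha⟩ := exists_freelyHomotopicIn_const_injConf n (f := amb f)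
      (fun s hs s' hs' => congrArg (fun x => (e x).1) (hbd f s hs s' hs')) (fun s => (e (f s)).2)
      fun i j hij => by
        have := hdeg f ⟨(i, j), hij⟩
        rwa [hf] at this
    exact GenLoop.homotopic_const_of_freelyHomotopicIn f (ha.of_homeomorph e
      (g := ContinuousMap.const _ (e.symm ⟨a, ha.right.2 0⟩)) (fun _ => rfl) fun _ => by simp)
  · obtain ⟨f, hfb, hfm, hfd⟩ := exists_pairDiff_single p.2
    let f' : C(Sq, X) := ⟨fun s => e.symm ⟨f s, hfm s⟩, by fun_prop⟩
    have hrank : 1 < Module.finrank ℝ (ℂ × ℝ) := by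
      simp [Module.finrank_prod, Complex.finrank_real_complex]
    have hj := ((joinedIn_iff_joined (e c).2 (hfm 0)).1
      (joinedIn_injConf hrank (e c).2 (hfm 0))).map e.symm.continuous
    rw [Subtype.coe_eta, e.symm_apply_apply] at hj
    obtain ⟨g, hg⟩ := exists_genLoop_freelyHomotopicIn (f := f') (c := c)
      (fun s hs s' hs' => congrArg e.symm (Subtype.ext (hfb s hs s' hs'))) hj.somePath
    refine ⟨g, huniq _ _ fun q => ?_⟩
    have hf' : amb f' = f := by
      ext s : 1
      simp [amb, f']
    have := (hfd q.1.1 q.1.2 q.2).of_freelyHomotopicIn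
      ((hf' ▸ hamb _ _ hg).symm.pairDiff q.2.ne)
    convert this using 1
    rw [Pi.single_apply]
    exact if_congr (by rw [Subtype.ext_iff, Prod.ext_iff]) rfl rfl

/-- **The second homotopy group of `Conf_n(ℝ³)`.**  For every `n ≥ 1` and every
basepoint `c`, the group `π₂(Conf_n(ℝ³), c)` is free abelian of rank `n(n−1)/2`,
i.e. isomorphic to `ℤ^{n(n−1)/2}`. -/
theorem pi2_conf_free_abelian (n : ℕ) (hn : 1 ≤ n) (c : Conf n (Set.univ : Set R3)) :
    Nonempty
      ((π_ 2 (Conf n (Set.univ : Set R3)) c) ≃*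
        Multiplicative (Fin (n * (n - 1) / 2) → ℤ)) := by
  exact nonempty_pi_two_of_homeomorph (confHomeo n) c

end
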